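/- arXiv:1706.03749 — 3 statements merged into one kernel-verified Lean document; each statement's English description precedes it below -/
import Mathlib

section
/- Mean value theorem for Dirichlet polynomials over prime powers (Lemma 2.6): There is an absolute constant C > 0 such that for every function a : ℕ → ℂ, every real x ≥ 1 and every real T ≥ 1, one has ∫_{−T}^{T} | ∑_{T² ≤ n ≤ x} a(n)·Λ(n)·n^{−it} |² dt ≤ C · ∑_{T² ≤ n ≤ x} n·|a(n)|²·Λ(n), where Λ is the von Mangoldt function. -/
open Complex
open scoped Classical

noncomputable section

/-- The squarefree integers in `[1, z]`. -/
def squarefreeUpTo (z : ℕ) : Finset ℕ := (Finset.Icc 1 z).filter Squarefree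

/-- The sum of `1 / φ k` over squarefree `k ≤ z`. -/
def selbergSum (z : ℕ) : ℝ := ∑ k ∈ squarefreeUpTo z, (k.totient : ℝ)⁻¹

/-- Selberg's optimal weights for the upper bound sieve by all primes up to `z`. -/
def selbergWeight (z d : ℕ) : ℝ :=
  ArithmeticFunction.moebius d * d *
    (∑ k ∈ (squarefreeUpTo z).filter (d ∣ ·), (k.totient : ℝ)⁻¹) / selbergSum z

lemma mem_squarefreeUpTo {z d : ℕ} : d ∈ squarefreeUpTo z ↔ (1 ≤ d ∧ d ≤ z) ∧ Squarefree d := by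
  simp [squarefreeUpTo]

lemma mem_squarefreeUpTo_of_dvd {z d k : ℕ} (hk : k ∈ squarefreeUpTo z) (h : d ∣ k) :
    d ∈ squarefreeUpTo z := by
  rw [mem_squarefreeUpTo] at *
  exact ⟨⟨Nat.pos_of_dvd_of_pos h hk.1.1, (Nat.le_of_dvd hk.1.1 h).trans hk.1.2⟩,
    hk.2.squarefree_of_dvd h⟩

lemma one_mem_squarefreeUpTo {z : ℕ} (hz : 1 ≤ z) : 1 ∈ squarefreeUpTo z := by
  simp [mem_squarefreeUpTo, hz]

lemma selbergSum_pos {z : ℕ} (hz : 1 ≤ z) : 0 < selbergSum z :=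
  Finset.sum_pos (fun k hk => by
    have := Nat.totient_pos.2 (mem_squarefreeUpTo.1 hk).1.1
    positivity) ⟨1, one_mem_squarefreeUpTo hz⟩

lemma selbergWeight_one {z : ℕ} (hz : 1 ≤ z) : selbergWeight z 1 = 1 := by
  have h := (selbergSum_pos hz).ne'
  rw [selbergSum] at h
  simp [selbergWeight, selbergSum, h]

lemma abs_selbergWeight_le {z : ℕ} (hz : 1 ≤ z) (d : ℕ) : |selbergWeight z d| ≤ d := by
  have hG := selbergSum_pos hz
  have hsub : ∑ k ∈ (squarefreeUpTo z).filter (d ∣ ·), (k.totient : ℝ)⁻¹ ≤ selbergSum z :=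
    Finset.sum_le_sum_of_subset_of_nonneg (Finset.filter_subset _ _) fun _ _ _ => by positivity
  have hnn : 0 ≤ ∑ k ∈ (squarefreeUpTo z).filter (d ∣ ·), (k.totient : ℝ)⁻¹ :=
    Finset.sum_nonneg fun _ _ => by positivity
  have hmu : |(ArithmeticFunction.moebius d : ℝ)| ≤ 1 := by
    exact_mod_cast ArithmeticFunction.abs_moebius_le_one (n := d)
  rw [selbergWeight, abs_div, abs_mul, abs_mul, abs_of_pos hG, abs_of_nonneg hnn, Nat.abs_cast,
    div_le_iff₀ hG]
  calc _ ≤ 1 * (d : ℝ) * selbergSum z := by gcongr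
    _ = _ := by ring

/-- The sum of `μ d` over the multiples `d` of `l` dividing a squarefree `k`. -/
lemma sum_moebius_divisors_filter_dvd {k l : ℕ} (hk : Squarefree k) :
    ∑ d ∈ k.divisors.filter (l ∣ ·), ArithmeticFunction.moebius d =
      if k = l then ArithmeticFunction.moebius l else 0 := by
  by_cases hl : l ∣ k
  · obtain ⟨m, rfl⟩ := hl
    have hne : l * m ≠ 0 := hk.ne_zero
    have hl0 : l ≠ 0 := left_ne_zero_of_mul hne
    have hm0 : m ≠ 0 := right_ne_zero_of_mul hne
    have hset : (l * m).divisors.filter (l ∣ ·) = m.divisors.image (l * ·) := by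
      ext d
      simp only [Finset.mem_filter, Nat.mem_divisors, Finset.mem_image]
      constructor
      · rintro ⟨⟨h1, -⟩, e, rfl⟩
        exact ⟨e, ⟨(Nat.mul_dvd_mul_iff_left (Nat.pos_of_ne_zero hl0)).1 h1, hm0⟩, rfl⟩
      · rintro ⟨e, ⟨h1, -⟩, rfl⟩
        exact ⟨⟨Nat.mul_dvd_mul_left l h1, hne⟩, dvd_mul_right _ _⟩
    rw [hset, Finset.sum_image fun a _ b _ h => Nat.eq_of_mul_eq_mul_left
      (Nat.pos_of_ne_zero hl0) h]
    have hmul : ∀ e ∈ m.divisors, ArithmeticFunction.moebius (l * e) =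
        ArithmeticFunction.moebius l * ArithmeticFunction.moebius e := fun e he =>
      ArithmeticFunction.isMultiplicative_moebius.map_mul_of_coprime
        ((Nat.coprime_of_squarefree_mul hk).coprime_dvd_right (Nat.dvd_of_mem_divisors he))
    rw [Finset.sum_congr rfl hmul, ← Finset.mul_sum, ← ArithmeticFunction.coe_mul_zeta_apply,
      ArithmeticFunction.moebius_mul_coe_zeta, ArithmeticFunction.one_apply]
    have : l * m = l ↔ m = 1 := by simp [hl0]
    simp [this]
  · have : k ≠ l := fun h => hl (h ▸ dvd_rfl)
    rw [if_neg this, Finset.sum_eq_zero]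
    intro d hd
    simp only [Finset.mem_filter, Nat.mem_divisors] at hd
    exact absurd (hd.2.trans hd.1.1) hl

lemma sum_selbergWeight_div {z l : ℕ} (hl : l ∈ squarefreeUpTo z) :
    ∑ d ∈ (squarefreeUpTo z).filter (l ∣ ·), selbergWeight z d / d =
      ArithmeticFunction.moebius l / (selbergSum z * l.totient) := by
  have hterm : ∀ d ∈ (squarefreeUpTo z).filter (l ∣ ·), selbergWeight z d / d =
      (selbergSum z)⁻¹ * ∑ k ∈ squarefreeUpTo z,
        if d ∣ k then (ArithmeticFunction.moebius d : ℝ) * (k.totient : ℝ)⁻¹ else 0 := by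
    intro d hd
    have hd0 : (d : ℝ) ≠ 0 := by
      have := (mem_squarefreeUpTo.1 (Finset.mem_filter.1 hd).1).1.1
      positivity
    rw [← Finset.sum_filter, ← Finset.mul_sum, selbergWeight]
    field_simp
  rw [Finset.sum_congr rfl hterm, ← Finset.mul_sum, Finset.sum_comm]
  have hinner : ∀ k ∈ squarefreeUpTo z, (∑ d ∈ (squarefreeUpTo z).filter (l ∣ ·),
      if d ∣ k then (ArithmeticFunction.moebius d : ℝ) * (k.totient : ℝ)⁻¹ else 0) =
      if k = l then (ArithmeticFunction.moebius l : ℝ) * (l.totient : ℝ)⁻¹ else 0 := by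
    intro k hk
    have hset : ((squarefreeUpTo z).filter (l ∣ ·)).filter (· ∣ k) =
        k.divisors.filter (l ∣ ·) := by
      ext d
      simp only [Finset.mem_filter, Nat.mem_divisors]
      exact ⟨fun h => ⟨⟨h.2, (mem_squarefreeUpTo.1 hk).2.ne_zero⟩, h.1.2⟩,
        fun h => ⟨⟨mem_squarefreeUpTo_of_dvd hk h.1.1, h.2⟩, h.1.1⟩⟩
    have hmu := congrArg (Int.cast : ℤ → ℝ)
      (sum_moebius_divisors_filter_dvd (l := l) (mem_squarefreeUpTo.1 hk).2)
    push_cast at hmu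
    rw [← Finset.sum_filter, hset, ← Finset.sum_mul, hmu]
    split_ifs with h <;> simp [h]
  rw [Finset.sum_congr rfl hinner, Finset.sum_ite_eq' _ l, if_pos hl]
  rw [div_eq_mul_inv, mul_inv]
  ring

/-- The diagonalised quadratic form attains the value `1 / selbergSum z`. -/
lemma sum_selbergWeight_mul_div_lcm {z : ℕ} (hz : 1 ≤ z) :
    ∑ d ∈ squarefreeUpTo z, ∑ e ∈ squarefreeUpTo z,
      selbergWeight z d * selbergWeight z e / (d.lcm e : ℝ) = (selbergSum z)⁻¹ := by
  have hterm : ∀ d ∈ squarefreeUpTo z, ∀ e ∈ squarefreeUpTo z,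
      selbergWeight z d * selbergWeight z e / (d.lcm e : ℝ) = ∑ l ∈ squarefreeUpTo z,
        (l.totient : ℝ) * ((if l ∣ d then selbergWeight z d / d else 0) *
          (if l ∣ e then selbergWeight z e / e else 0)) := by
    intro d hd e he
    have hd0 : 0 < d := (mem_squarefreeUpTo.1 hd).1.1
    have he0 : 0 < e := (mem_squarefreeUpTo.1 he).1.1
    have hset : (squarefreeUpTo z).filter (fun l => l ∣ d ∧ l ∣ e) = (d.gcd e).divisors := by
      ext l
      simp only [Finset.mem_filter, Nat.mem_divisors, Nat.dvd_gcd_iff]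
      exact ⟨fun h => ⟨h.2, (Nat.gcd_pos_of_pos_left _ hd0).ne'⟩,
        fun h => ⟨mem_squarefreeUpTo_of_dvd hd h.1.1, h.1⟩⟩
    have hg : ((d.gcd e : ℕ) : ℝ) =
        ∑ l ∈ (squarefreeUpTo z).filter (fun l => l ∣ d ∧ l ∣ e), (l.totient : ℝ) := by
      rw [hset]
      exact_mod_cast (Nat.sum_totient _).symm
    have hgl : ((d.gcd e : ℕ) : ℝ) * (d.lcm e : ℝ) = d * e := by
      exact_mod_cast Nat.gcd_mul_lcm d e
    have hlcm : (d.lcm e : ℝ) ≠ 0 := by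
      exact_mod_cast (Nat.lcm_pos hd0 he0).ne'
    have hd' : (d : ℝ) ≠ 0 := by positivity
    have he' : (e : ℝ) ≠ 0 := by positivity
    calc selbergWeight z d * selbergWeight z e / (d.lcm e : ℝ)
        = (d.gcd e : ℕ) * (selbergWeight z d / d * (selbergWeight z e / e)) := by
          field_simp
          linear_combination (-selbergWeight z d * selbergWeight z e) * hgl
      _ = _ := by
          rw [hg, Finset.sum_mul, Finset.sum_filter]
          refine Finset.sum_congr rfl fun l _ => ?_
          by_cases h1 : l ∣ d <;> by_cases h2 : l ∣ e <;> simp [h1, h2]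
  have hG := selbergSum_pos hz
  calc _ = ∑ l ∈ squarefreeUpTo z, (l.totient : ℝ) *
        (∑ d ∈ (squarefreeUpTo z).filter (l ∣ ·), selbergWeight z d / d) ^ 2 := by
        rw [Finset.sum_congr rfl fun d hd => Finset.sum_congr rfl (hterm d hd)]
        rw [Finset.sum_congr rfl fun d _ => Finset.sum_comm, Finset.sum_comm]
        refine Finset.sum_congr rfl fun l _ => ?_
        rw [sq, Finset.sum_filter, Finset.sum_mul_sum, Finset.mul_sum]
        refine Finset.sum_congr rfl fun d _ => ?_
        rw [Finset.mul_sum]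
    _ = ∑ l ∈ squarefreeUpTo z, (l.totient : ℝ)⁻¹ * (selbergSum z ^ 2)⁻¹ := by
        refine Finset.sum_congr rfl fun l hl => ?_
        have hl' := mem_squarefreeUpTo.1 hl
        have hφ : (l.totient : ℝ) ≠ 0 := by
          have := Nat.totient_pos.2 hl'.1.1
          positivity
        have hmu : (ArithmeticFunction.moebius l : ℝ) ^ 2 = 1 := by
          exact_mod_cast ArithmeticFunction.moebius_sq_eq_one_of_squarefree hl'.2
        rw [sum_selbergWeight_div hl, div_pow, hmu]
        field_simp
    _ = _ := by
        rw [← Finset.sum_mul, ← selbergSum]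
        field_simp

lemma abs_card_filter_dvd_sub_le (N M : ℕ) {d : ℕ} (hd : 0 < d) :
    |(((Finset.Ioc N (N + M)).filter (d ∣ ·)).card : ℝ) - M / d| ≤ 1 := by
  have hsplit : ((Finset.Ioc N (N + M)).filter (d ∣ ·)).card + N / d = (N + M) / d := by
    rw [← Nat.Ioc_filter_dvd_card_eq_div, ← Nat.Ioc_filter_dvd_card_eq_div, add_comm,
      ← Finset.card_union_of_disjoint, ← Finset.filter_union,
      Finset.Ioc_union_Ioc_eq_Ioc (Nat.zero_le N) (Nat.le_add_right N M)]
    exact Finset.disjoint_filter_filter (Finset.Ioc_disjoint_Ioc_of_le le_rfl)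
  have h1 : (((Finset.Ioc N (N + M)).filter (d ∣ ·)).card : ℝ) + (N / d : ℕ) =
      ((N + M) / d : ℕ) := by exact_mod_cast hsplit
  have hd' : (0 : ℝ) < d := by exact_mod_cast hd
  have h2 : ((N / d : ℕ) : ℝ) ≤ N / d := Nat.cast_div_le
  have h3 : (N : ℝ) / d < (N / d : ℕ) + 1 := by
    rw [div_lt_iff₀ hd']
    exact_mod_cast Nat.lt_mul_of_div_lt (Nat.lt_succ_self _) hd
  have h4 : (((N + M) / d : ℕ) : ℝ) ≤ (N + M) / d := by exact_mod_cast Nat.cast_div_le (α := ℝ)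
  have h5 : ((N : ℝ) + M) / d < ((N + M) / d : ℕ) + 1 := by
    rw [div_lt_iff₀ hd']
    exact_mod_cast Nat.lt_mul_of_div_lt (Nat.lt_succ_self _) hd
  rw [add_div] at h4 h5
  rw [abs_le]
  constructor <;> linarith

/-- Selberg's upper bound for the number of integers in `(N, N + M]` free of primes up to `z`. -/
lemma card_sifted_le (N M : ℕ) {z : ℕ} (hz : 1 ≤ z) :
    (((Finset.Ioc N (N + M)).filter
      (fun n => ∀ d ∈ squarefreeUpTo z, d ∣ n → d = 1)).card : ℝ) ≤
      M / selbergSum z + z ^ 4 := by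
  calc _ = ∑ n ∈ (Finset.Ioc N (N + M)).filter
        (fun n => ∀ d ∈ squarefreeUpTo z, d ∣ n → d = 1), (1 : ℝ) := by simp
    _ ≤ ∑ n ∈ Finset.Ioc N (N + M),
        (∑ d ∈ squarefreeUpTo z, if d ∣ n then selbergWeight z d else 0) ^ 2 := by
        rw [Finset.sum_filter]
        refine Finset.sum_le_sum fun n _ => ?_
        split_ifs with h
        · have : ∑ d ∈ squarefreeUpTo z, (if d ∣ n then selbergWeight z d else 0) = 1 := by
            rw [Finset.sum_eq_single_of_mem 1 (one_mem_squarefreeUpTo hz)]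
            · simp [selbergWeight_one hz]
            · intro d hd hd1
              exact if_neg fun hdn => hd1 (h d hd hdn)
          rw [this, one_pow]
        · positivity
    _ = ∑ d ∈ squarefreeUpTo z, ∑ e ∈ squarefreeUpTo z, selbergWeight z d * selbergWeight z e *
          (((Finset.Ioc N (N + M)).filter (d.lcm e ∣ ·)).card : ℝ) := by
        simp_rw [sq, Finset.sum_mul_sum]
        rw [Finset.sum_comm]
        refine Finset.sum_congr rfl fun d _ => ?_
        rw [Finset.sum_comm]
        refine Finset.sum_congr rfl fun e _ => ?_
        rw [Finset.card_filter, Nat.cast_sum, Finset.mul_sum]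
        refine Finset.sum_congr rfl fun n _ => ?_
        by_cases h1 : d ∣ n <;> by_cases h2 : e ∣ n <;> simp [h1, h2, Nat.lcm_dvd_iff]
    _ ≤ ∑ d ∈ squarefreeUpTo z, ∑ e ∈ squarefreeUpTo z,
          (M * (selbergWeight z d * selbergWeight z e / (d.lcm e : ℝ)) + z * z) := by
        refine Finset.sum_le_sum fun d hd => Finset.sum_le_sum fun e he => ?_
        have hd' := mem_squarefreeUpTo.1 hd
        have he' := mem_squarefreeUpTo.1 he
        have hc := abs_card_filter_dvd_sub_le N M (Nat.lcm_pos hd'.1.1 he'.1.1)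
        have hw : |selbergWeight z d * selbergWeight z e| ≤ z * z := by
          rw [abs_mul]
          have h1 : (d : ℝ) ≤ z := by exact_mod_cast hd'.1.2
          have h2 : (e : ℝ) ≤ z := by exact_mod_cast he'.1.2
          exact mul_le_mul ((abs_selbergWeight_le hz d).trans h1)
            ((abs_selbergWeight_le hz e).trans h2) (abs_nonneg _) (by positivity)
        have hb := (le_abs_self _).trans
          ((abs_mul (selbergWeight z d * selbergWeight z e) _).le.trans
            (mul_le_mul hw hc (abs_nonneg _) (by positivity)))
        calc _ = M * (selbergWeight z d * selbergWeight z e / (d.lcm e : ℝ)) +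
              selbergWeight z d * selbergWeight z e *
              ((((Finset.Ioc N (N + M)).filter (d.lcm e ∣ ·)).card : ℝ) - M / (d.lcm e : ℝ)) := by
              ring
          _ ≤ _ := by linarith
    _ = M / selbergSum z + ((squarefreeUpTo z).card : ℝ) ^ 2 * (z * z) := by
        simp_rw [Finset.sum_add_distrib, ← Finset.mul_sum, sum_selbergWeight_mul_div_lcm hz]
        simp only [Finset.sum_const, nsmul_eq_mul]
        ring
    _ ≤ _ := by
        have hcard : ((squarefreeUpTo z).card : ℝ) ≤ z := by
          exact_mod_cast (Finset.card_filter_le _ _).trans (by simp)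
        have : ((squarefreeUpTo z).card : ℝ) ^ 2 ≤ (z : ℝ) ^ 2 := by gcongr
        nlinarith [mul_nonneg (Nat.cast_nonneg (α := ℝ) z) (Nat.cast_nonneg (α := ℝ) z)]

lemma sum_inv_sq_le_two (z : ℕ) : ∑ m ∈ Finset.Icc 1 z, ((m : ℝ) ^ 2)⁻¹ ≤ 2 := by
  suffices h : ∑ m ∈ Finset.Icc 1 z, ((m : ℝ) ^ 2)⁻¹ ≤ 2 - (z : ℝ)⁻¹ by
    have : (0 : ℝ) ≤ (z : ℝ)⁻¹ := by positivity
    linarith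
  induction z with
  | zero => simp
  | succ n ih =>
    rw [Finset.sum_Icc_succ_top (by omega)]
    rcases Nat.eq_zero_or_pos n with rfl | hn
    · norm_num
    · have hn' : (0 : ℝ) < n := by exact_mod_cast hn
      have : (((n + 1 : ℕ) : ℝ) ^ 2)⁻¹ ≤ (n : ℝ)⁻¹ - ((n + 1 : ℕ) : ℝ)⁻¹ := by
        push_cast
        rw [inv_sub_inv (by positivity) (by positivity), inv_eq_one_div,
          div_le_div_iff₀ (by positivity) (by positivity)]
        nlinarith
      linarith

lemma Icc_subset_image_squarefreeUpTo (z : ℕ) :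
    Finset.Icc 1 z ⊆
      (squarefreeUpTo z ×ˢ Finset.Icc 1 z).image (fun p => p.2 ^ 2 * p.1) := by
  intro n hn
  rw [Finset.mem_Icc] at hn
  obtain ⟨k, m, rfl, hk⟩ := Nat.sq_mul_squarefree n
  have hk0 : 0 < k := Nat.pos_of_ne_zero hk.ne_zero
  have hm0 : 0 < m := Nat.pos_of_ne_zero fun h => by simp [h] at hn
  simp only [Finset.mem_image, Finset.mem_product, mem_squarefreeUpTo, Finset.mem_Icc]
  refine ⟨(k, m), ⟨⟨⟨hk0, ?_⟩, hk⟩, hm0, ?_⟩, rfl⟩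
  · exact (Nat.le_mul_of_pos_left k (by positivity)).trans hn.2
  · exact ((Nat.le_self_pow two_ne_zero m).trans (Nat.le_mul_of_pos_right _ hk0)).trans hn.2

lemma log_le_two_mul_selbergSum (z : ℕ) : Real.log (z + 1) ≤ 2 * selbergSum z := by
  have hharm : Real.log (z + 1) ≤ ∑ n ∈ Finset.Icc 1 z, (n : ℝ)⁻¹ := by
    have h := log_add_one_le_harmonic z
    rw [harmonic_eq_sum_Icc] at h
    push_cast at h
    exact h
  have himage := Finset.sum_image_le_of_nonneg (s := squarefreeUpTo z ×ˢ Finset.Icc 1 z)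
    (g := fun p : ℕ × ℕ => p.2 ^ 2 * p.1) (f := fun n : ℕ => (n : ℝ)⁻¹)
    fun _ _ => by positivity
  calc Real.log (z + 1) ≤ ∑ n ∈ Finset.Icc 1 z, (n : ℝ)⁻¹ := hharm
    _ ≤ ∑ n ∈ (squarefreeUpTo z ×ˢ Finset.Icc 1 z).image (fun p => p.2 ^ 2 * p.1),
          ((n : ℕ) : ℝ)⁻¹ :=
        Finset.sum_le_sum_of_subset_of_nonneg (Icc_subset_image_squarefreeUpTo z)
          fun _ _ _ => by positivity
    _ ≤ ∑ p ∈ squarefreeUpTo z ×ˢ Finset.Icc 1 z, ((p.2 ^ 2 * p.1 : ℕ) : ℝ)⁻¹ := himage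
    _ = (∑ k ∈ squarefreeUpTo z, (k : ℝ)⁻¹) * ∑ m ∈ Finset.Icc 1 z, ((m : ℝ) ^ 2)⁻¹ := by
        rw [Finset.sum_product, Finset.sum_mul_sum]
        refine Finset.sum_congr rfl fun k _ => Finset.sum_congr rfl fun m _ => ?_
        push_cast
        rw [mul_inv, mul_comm]
    _ ≤ selbergSum z * 2 := by
        refine mul_le_mul (Finset.sum_le_sum fun k hk => ?_) (sum_inv_sq_le_two z)
          (Finset.sum_nonneg fun _ _ => by positivity)
          (Finset.sum_nonneg fun _ _ => by positivity)
        have : 0 < k.totient := Nat.totient_pos.2 (mem_squarefreeUpTo.1 hk).1.1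
        exact inv_anti₀ (by exact_mod_cast this) (by exact_mod_cast Nat.totient_le k)
    _ = _ := mul_comm _ _

lemma exists_pow_le_lt_succ_pow {k M : ℕ} (hk : k ≠ 0) (hM : 1 ≤ M) :
    ∃ z : ℕ, 1 ≤ z ∧ z ^ k ≤ M ∧ M < (z + 1) ^ k := by
  refine ⟨Nat.findGreatest (fun z => z ^ k ≤ M) M, ?_, ?_, ?_⟩
  · exact Nat.le_findGreatest hM (by simpa using hM)
  · exact Nat.findGreatest_spec (P := fun z => z ^ k ≤ M) hM (by simpa using hM)
  · by_contra! h
    have hle := (Nat.le_self_pow hk _).trans h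
    have := Nat.le_findGreatest (P := fun z => z ^ k ≤ M) hle h
    omega

/-- The contribution to `ψ(X)` of the prime powers having a divisor in `(1, z]`. -/
lemma sum_vonMangoldt_filter_le {X z : ℕ} (s : Finset ℕ) (hs : s ⊆ Finset.Icc 1 X)
    (hdiv : ∀ n ∈ s, ∃ d ≤ z, d ∣ n ∧ d ≠ 1) :
    ∑ n ∈ s, ArithmeticFunction.vonMangoldt n ≤ 2 * z * Real.log X ^ 2 := by
  rcases Nat.eq_zero_or_pos X with rfl | hX
  · have : s = ∅ := Finset.subset_empty.1 (by simpa using hs)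
    simp [this]
  have hL : 0 ≤ Real.log X := Real.log_natCast_nonneg X
  have hsub : s.filter IsPrimePow ⊆
      (Finset.Icc 1 z ×ˢ Finset.Icc 1 (Nat.log 2 X)).image (fun q : ℕ × ℕ => q.1 ^ q.2) := by
    intro n hn
    obtain ⟨hns, hpp⟩ := Finset.mem_filter.1 hn
    obtain ⟨p, k, hp, hk, rfl⟩ := (isPrimePow_nat_iff n).1 hpp
    obtain ⟨d, hdz, hdn, hd1⟩ := hdiv _ hns
    have hX' := Finset.mem_Icc.1 (hs hns)
    obtain ⟨q, hq, hqd⟩ := Nat.exists_prime_and_dvd hd1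
    have hqp : q = p := (Nat.prime_dvd_prime_iff_eq hq hp).1 (hq.dvd_of_dvd_pow (hqd.trans hdn))
    have hd0 : 0 < d := Nat.pos_of_dvd_of_pos hdn hX'.1
    have hpz : p ≤ z := hqp ▸ (Nat.le_of_dvd hd0 hqd).trans hdz
    have hkX : k ≤ Nat.log 2 X := by
      apply Nat.le_log_of_pow_le (by norm_num)
      exact (Nat.pow_le_pow_left hp.two_le k).trans hX'.2
    simp only [Finset.mem_image, Finset.mem_product, Finset.mem_Icc]
    exact ⟨(p, k), ⟨⟨hp.one_le, hpz⟩, hk, hkX⟩, rfl⟩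
  have hcard : ((s.filter IsPrimePow).card : ℝ) ≤ z * Nat.log 2 X := by
    have := (Finset.card_le_card hsub).trans Finset.card_image_le
    rw [Finset.card_product, Nat.card_Icc, Nat.card_Icc] at this
    exact_mod_cast this
  have hlog : (Nat.log 2 X : ℝ) ≤ 2 * Real.log X := by
    have h1 : ((2 : ℝ) ^ Nat.log 2 X) ≤ X := by
      exact_mod_cast Nat.pow_log_le_self 2 hX.ne'
    have h2 := Real.log_le_log (by positivity) h1
    rw [Real.log_pow] at h2
    have := Real.log_two_gt_d9
    nlinarith [Nat.cast_nonneg (α := ℝ) (Nat.log 2 X)]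
  calc ∑ n ∈ s, ArithmeticFunction.vonMangoldt n
      = ∑ n ∈ s.filter IsPrimePow, ArithmeticFunction.vonMangoldt n := by
        rw [Finset.sum_filter_of_ne]
        exact fun n _ h => ArithmeticFunction.vonMangoldt_ne_zero_iff.1 h
    _ ≤ ∑ n ∈ s.filter IsPrimePow, Real.log X := by
        refine Finset.sum_le_sum fun n hn => ArithmeticFunction.vonMangoldt_le_log.trans ?_
        have := Finset.mem_Icc.1 (hs (Finset.mem_filter.1 hn).1)
        exact Real.log_le_log (by exact_mod_cast this.1) (by exact_mod_cast this.2)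
    _ = (s.filter IsPrimePow).card * Real.log X := by simp
    _ ≤ (z * (2 * Real.log X)) * Real.log X := by
        gcongr
        exact hcard.trans (by gcongr)
    _ = _ := by ring

/-- A Brun–Titchmarsh type bound for prime powers in intervals of length at least the square root
of their left end point. -/
theorem sum_vonMangoldt_Ioc_le {N M : ℕ} (hM : 2 ≤ M) (hN : N ≤ M ^ 2) :
    ∑ n ∈ Finset.Ioc N (N + M), ArithmeticFunction.vonMangoldt n ≤ 1224 * M := by
  obtain ⟨z, hz, hzM, hMz⟩ := exists_pow_le_lt_succ_pow (k := 8) (by norm_num) (by omega : 1 ≤ M)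
  have hzR : (1 : ℝ) ≤ z := by exact_mod_cast hz
  have hzMR : (z : ℝ) ^ 8 ≤ M := by exact_mod_cast hzM
  set L := Real.log ((N + M : ℕ) : ℝ)
  have hL0 : 0 ≤ L := Real.log_natCast_nonneg _
  have hLz : L ≤ 24 * Real.log (z + 1) := by
    have h1 : N + M ≤ ((z + 1) ^ 8) ^ 3 := by
      calc N + M ≤ M ^ 3 := by nlinarith
        _ ≤ _ := Nat.pow_le_pow_left hMz.le 3
    have h2 : ((N + M : ℕ) : ℝ) ≤ ((z : ℝ) + 1) ^ 24 := by
      rw [← pow_mul] at h1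
      exact_mod_cast h1
    have h3 := Real.log_le_log (by exact_mod_cast (by omega : 0 < N + M)) h2
    rw [Real.log_pow] at h3
    exact_mod_cast h3
  have hLz' : L ≤ 24 * z := by
    have := Real.log_le_sub_one_of_pos (by positivity : (0 : ℝ) < z + 1)
    linarith
  have hG := selbergSum_pos hz
  have hLG : L ≤ 48 * selbergSum z := by
    linarith [log_le_two_mul_selbergSum z]
  set P : ℕ → Prop := fun n => ∀ d ∈ squarefreeUpTo z, d ∣ n → d = 1 with hP
  rw [← Finset.sum_filter_add_sum_filter_not _ P]
  have hsift : ∑ n ∈ (Finset.Ioc N (N + M)).filter P, ArithmeticFunction.vonMangoldt n ≤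
      72 * M := by
    calc _ ≤ ∑ n ∈ (Finset.Ioc N (N + M)).filter P, L := by
          refine Finset.sum_le_sum fun n hn => ArithmeticFunction.vonMangoldt_le_log.trans ?_
          have := Finset.mem_Ioc.1 (Finset.mem_filter.1 hn).1
          exact Real.log_le_log (by exact_mod_cast (by omega : 0 < n)) (by exact_mod_cast this.2)
      _ = ((Finset.Ioc N (N + M)).filter P).card * L := by simp
      _ ≤ (M / selbergSum z + z ^ 4) * L := by
          gcongr
          exact card_sifted_le N M hz
      _ = M * (L / selbergSum z) + z ^ 4 * L := by ring
      _ ≤ M * 48 + z ^ 4 * (24 * z) := by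
          gcongr
          rwa [div_le_iff₀ hG]
      _ = M * 48 + 24 * z ^ 5 := by ring
      _ ≤ M * 48 + 24 * z ^ 8 := by
          gcongr
          norm_num
      _ ≤ _ := by linarith
  have hrest : ∑ n ∈ (Finset.Ioc N (N + M)).filter (fun n => ¬ P n),
      ArithmeticFunction.vonMangoldt n ≤ 1152 * M := by
    calc _ ≤ 2 * z * L ^ 2 := by
          refine sum_vonMangoldt_filter_le _ (fun n hn => ?_) fun n hn => ?_
          · have := Finset.mem_Ioc.1 (Finset.mem_filter.1 hn).1
            exact Finset.mem_Icc.2 ⟨by omega, this.2⟩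
          · have := (Finset.mem_filter.1 hn).2
            simp only [hP, not_forall] at this
            obtain ⟨d, hd, hdn, hd1⟩ := this
            exact ⟨d, (mem_squarefreeUpTo.1 hd).1.2, hdn, hd1⟩
      _ ≤ 2 * z * (24 * z) ^ 2 := by gcongr
      _ = 1152 * z ^ 3 := by ring
      _ ≤ 1152 * z ^ 8 := by
          gcongr
          norm_num
      _ ≤ _ := by linarith
  linarith

/-- Prime powers in multiplicatively short windows around `n ≥ T ^ 2`. -/
theorem sum_vonMangoldt_window_le {T : ℝ} (hT : 1 ≤ T) {n : ℕ} (hn : T ^ 2 ≤ n) (s : Finset ℕ)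
    (hs : ∀ m ∈ s, 0 < m ∧ |Real.log m - Real.log n| ≤ 1 / T) :
    ∑ m ∈ s, ArithmeticFunction.vonMangoldt m ≤ 6120 * (n / T) := by
  have hT0 : 0 < T := by linarith
  have hn1 : (1 : ℝ) ≤ n := by nlinarith
  have hTinv : 1 / T ≤ 1 := by rw [div_le_one hT0]; exact hT
  have hTinv0 : 0 < 1 / T := by positivity
  set h : ℝ := n / T with hh
  have hTh : T ≤ h := by rw [hh, le_div_iff₀ hT0]; nlinarith
  have hnh : (n : ℝ) ≤ h ^ 2 := by
    have : (n : ℝ) = h * T := by rw [hh]; field_simp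
    rw [this, sq]
    gcongr
  set N : ℕ := ⌈(n : ℝ) - h⌉₊ - 1 with hNdef
  set M : ℕ := ⌈3 * h⌉₊ + 1 with hMdef
  have hM1 : 3 * h ≤ ⌈3 * h⌉₊ := Nat.le_ceil _
  have hM2 : (⌈3 * h⌉₊ : ℝ) < 3 * h + 1 := Nat.ceil_lt_add_one (by linarith)
  have hMR : (M : ℝ) = ⌈3 * h⌉₊ + 1 := by rw [hMdef]; push_cast; rfl
  have hM : 2 ≤ M := by
    have : (2 : ℝ) ≤ M := by linarith
    exact_mod_cast this
  have hNn : N ≤ n := by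
    have : ⌈(n : ℝ) - h⌉₊ ≤ n := Nat.ceil_le.2 (by linarith)
    omega
  have hN : N ≤ M ^ 2 := by
    have h2 : (N : ℝ) ≤ (M : ℝ) ^ 2 := by
      have : (N : ℝ) ≤ n := by exact_mod_cast hNn
      nlinarith
    exact_mod_cast h2
  have hexp_up : Real.exp (1 / T) ≤ 1 + 2 * (1 / T) := by
    have := Real.abs_exp_sub_one_le (x := 1 / T) (by rw [abs_of_pos hTinv0]; exact hTinv)
    rw [abs_of_pos hTinv0] at this
    linarith [(abs_le.1 this).2]
  have hexp_lo : 1 - 1 / T ≤ Real.exp (-(1 / T)) := by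
    linarith [Real.add_one_le_exp (-(1 / T))]
  have hsub : s ⊆ Finset.Ioc N (N + M) := by
    intro m hm
    obtain ⟨hm0, hlog⟩ := hs m hm
    have hmR : (0 : ℝ) < m := by exact_mod_cast hm0
    have hn0 : (0 : ℝ) < n := by linarith
    rw [abs_le] at hlog
    have hup : (m : ℝ) ≤ n + 2 * h := by
      calc (m : ℝ) = Real.exp (Real.log m) := (Real.exp_log hmR).symm
        _ ≤ Real.exp (Real.log n + 1 / T) := Real.exp_le_exp.2 (by linarith)
        _ = n * Real.exp (1 / T) := by rw [Real.exp_add, Real.exp_log hn0]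
        _ ≤ n * (1 + 2 * (1 / T)) := by gcongr
        _ = _ := by rw [hh]; ring
    have hlo : n - h ≤ (m : ℝ) := by
      calc n - h = n * (1 - 1 / T) := by rw [hh]; ring
        _ ≤ n * Real.exp (-(1 / T)) := by gcongr
        _ = Real.exp (Real.log n + -(1 / T)) := by rw [Real.exp_add, Real.exp_log hn0]
        _ ≤ Real.exp (Real.log m) := Real.exp_le_exp.2 (by linarith)
        _ = m := Real.exp_log hmR
    have hc : ⌈(n : ℝ) - h⌉₊ ≤ m := Nat.ceil_le.2 hlo
    have hNlow : (n : ℝ) - h ≤ N + 1 := by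
      have h1 : ⌈(n : ℝ) - h⌉₊ ≤ N + 1 := by omega
      exact (Nat.le_ceil _).trans (by exact_mod_cast h1)
    rw [Finset.mem_Ioc]
    refine ⟨by omega, ?_⟩
    have : (m : ℝ) ≤ N + M := by linarith
    exact_mod_cast this
  calc _ ≤ ∑ m ∈ Finset.Ioc N (N + M), ArithmeticFunction.vonMangoldt m :=
        Finset.sum_le_sum_of_subset_of_nonneg hsub
          fun _ _ _ => ArithmeticFunction.vonMangoldt_nonneg
    _ ≤ 1224 * M := sum_vonMangoldt_Ioc_le hM hN
    _ ≤ _ := by linarith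

/-- A smooth bump function supported in `[-1/2, 1/2]`. -/
def unitBump : ContDiffBump (0 : ℝ) := ⟨1 / 4, 1 / 2, by norm_num, by norm_num⟩

lemma unitBump_eq_zero {v : ℝ} (hv : 1 / 2 ≤ |v|) : unitBump v = 0 :=
  unitBump.zero_of_le_dist (by simpa [unitBump, Real.dist_eq] using hv)

lemma integral_unitBump_pos : 0 < ∫ v, unitBump v := unitBump.integral_pos

/-- The Fourier transform of the bump function is bounded below near the origin. -/
lemma integral_unitBump_le_norm_fourier {w : ℝ} (hw : |w| ≤ 1 / (2 * Real.pi)) :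
    (∫ v, unitBump v) / 2 ≤ ‖FourierTransform.fourier (fun v => (unitBump v : ℂ)) w‖ := by
  have hpi := Real.pi_pos
  have hint : MeasureTheory.Integrable (fun v : ℝ =>
      Complex.exp (↑(-2 * Real.pi * v * w) * Complex.I) * (unitBump v : ℂ)) := by
    refine Continuous.integrable_of_hasCompactSupport ?_ ?_
    · have := unitBump.continuous
      fun_prop
    · exact (unitBump.hasCompactSupport.comp_left (g := ((↑) : ℝ → ℂ)) (by simp)).mul_left
  simp_rw [Real.fourier_real_eq_integral_exp_smul, smul_eq_mul]
  refine le_trans ?_ (Complex.re_le_norm _)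
  have hre := integral_re hint
  simp only [RCLike.re_eq_complex_re] at hre
  rw [← hre, ← MeasureTheory.integral_div]
  refine MeasureTheory.integral_mono (unitBump.integrable.div_const 2) hint.re fun v => ?_
  have hreal : (Complex.exp (↑(-2 * Real.pi * v * w) * Complex.I) * (unitBump v : ℂ)).re =
      Real.cos (-2 * Real.pi * v * w) * unitBump v := by
    rw [Complex.re_mul_ofReal, Complex.exp_ofReal_mul_I_re]
  simp only [hreal]
  rcases le_or_gt (1 / 2) |v| with hv | hv
  · simp [unitBump_eq_zero hv]
  · have hx : |-2 * Real.pi * v * w| ≤ 1 := by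
      rw [abs_mul, abs_mul, abs_mul, abs_of_pos hpi]
      rw [le_div_iff₀ (by positivity)] at hw
      norm_num
      nlinarith [abs_nonneg v, abs_nonneg w, mul_nonneg (abs_nonneg w) hpi.le]
    have hcos := Real.one_sub_sq_div_two_le_cos (x := -2 * Real.pi * v * w)
    have hsq : (-2 * Real.pi * v * w) ^ 2 ≤ 1 := (sq_le_one_iff_abs_le_one _).2 hx
    nlinarith [unitBump.nonneg (x := v)]

lemma fourier_comp_mul_sub (f : ℝ → ℂ) {T : ℝ} (hT : 0 < T) (l w : ℝ) :
    FourierTransform.fourier (fun v => f (T * (v - l))) w =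
      Complex.exp (↑(-2 * Real.pi * l * w) * Complex.I) *
        (T⁻¹ * FourierTransform.fourier f (w / T)) := by
  simp_rw [Real.fourier_real_eq_integral_exp_smul, smul_eq_mul]
  have h1 := MeasureTheory.integral_sub_right_eq_self (μ := MeasureTheory.volume)
    (fun v : ℝ => Complex.exp (↑(-2 * Real.pi * (v + l) * w) * Complex.I) * f (T * v)) l
  simp only [sub_add_cancel] at h1
  rw [h1]
  have h2 := MeasureTheory.Measure.integral_comp_mul_left
    (fun v : ℝ => Complex.exp (↑(-2 * Real.pi * v * (w / T)) * Complex.I) * f v) T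
  rw [abs_of_pos (inv_pos.2 hT), Complex.real_smul] at h2
  rw [← h2, ← MeasureTheory.integral_const_mul]
  congr 1
  ext v
  rw [← mul_assoc, ← Complex.exp_add]
  congr 2
  have : (T : ℂ) ≠ 0 := by exact_mod_cast hT.ne'
  push_cast
  field_simp
  ring

lemma contDiff_unitBump_comp (T l : ℝ) {n : ℕ∞} :
    ContDiff ℝ n (fun v => (unitBump (T * (v - l)) : ℂ)) :=
  Complex.ofRealCLM.contDiff.comp (unitBump.contDiff.comp (by fun_prop))

lemma hasCompactSupport_unitBump_comp {T : ℝ} (hT : 0 < T) (l : ℝ) :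
    HasCompactSupport (fun v => unitBump (T * (v - l))) := by
  refine HasCompactSupport.intro (isCompact_Icc (a := l - 1 / T) (b := l + 1 / T)) fun v hv => ?_
  refine unitBump_eq_zero ?_
  by_contra! h
  apply hv
  rw [abs_mul, abs_of_pos hT, mul_comm, ← lt_div_iff₀ hT] at h
  have h' : (1 / 2) / T ≤ 1 / T := by gcongr; norm_num
  have := abs_lt.1 h
  exact ⟨by linarith, by linarith⟩

lemma integral_unitBump_comp {T : ℝ} (hT : 0 < T) (l : ℝ) :
    ∫ v, unitBump (T * (v - l)) = T⁻¹ * ∫ v, unitBump v := by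
  rw [MeasureTheory.integral_sub_right_eq_self (fun v => unitBump (T * v)) l,
    MeasureTheory.Measure.integral_comp_mul_left, abs_of_pos (inv_pos.2 hT), smul_eq_mul]

/-- A form of Gallagher's lemma with a smooth cutoff. -/
lemma integral_norm_sq_expSum_le {ι : Type*} (s : Finset ι) (b : ι → ℂ) (l : ι → ℝ) {T : ℝ}
    (hT : 0 < T) :
    ∫ t in (-T)..T, ‖∑ i ∈ s, b i * Complex.exp (-((t * l i : ℝ) : ℂ) * Complex.I)‖ ^ 2 ≤
      2 * Real.pi * (2 * T / ∫ v, unitBump v) ^ 2 *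
        ∫ u, ‖∑ i ∈ s, b i * (unitBump (T * (u - l i)) : ℂ)‖ ^ 2 := by
  have hpi := Real.pi_pos
  have hB := integral_unitBump_pos
  set B := ∫ v, unitBump v
  set F : ℝ → ℂ := fun t => ∑ i ∈ s, b i * Complex.exp (-((t * l i : ℝ) : ℂ) * Complex.I) with hF
  have hFc : Continuous F := by fun_prop
  set H : ℝ → ℂ := fun u => ∑ i ∈ s, b i * (unitBump (T * (u - l i)) : ℂ) with hH
  have hHd : ContDiff ℝ ((⊤ : ℕ∞) : WithTop ℕ∞) H :=
    ContDiff.sum fun i _ => contDiff_const.mul (contDiff_unitBump_comp T (l i))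
  have hsupp : ∀ i, HasCompactSupport (fun u => (unitBump (T * (u - l i)) : ℂ)) := fun i =>
    (hasCompactSupport_unitBump_comp hT (l i)).comp_left (g := ((↑) : ℝ → ℂ)) (by simp)
  have hHs : HasCompactSupport H := by
    have : H = ∑ i ∈ s, fun u => b i * (unitBump (T * (u - l i)) : ℂ) := by
      ext u; simp [hH]
    rw [this]
    exact Finset.sum_induction _ HasCompactSupport (fun _ _ => HasCompactSupport.add)
      HasCompactSupport.zero fun i _ => (hsupp i).mul_left
  set S := hHs.toSchwartzMap hHd
  have hfourier : ∀ w, FourierTransform.fourier S w = F (2 * Real.pi * w) *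
      (T⁻¹ * FourierTransform.fourier (fun v => (unitBump v : ℂ)) (w / T)) := by
    intro w
    have hint : ∀ i ∈ s, MeasureTheory.Integrable (fun v : ℝ =>
        Complex.exp (↑(-2 * Real.pi * v * w) * Complex.I) *
          (b i * (unitBump (T * (v - l i)) : ℂ))) := fun i _ => by
      refine Continuous.integrable_of_hasCompactSupport ?_ ((hsupp i).mul_left.mul_left)
      have := unitBump.continuous
      fun_prop
    have hcoe : FourierTransform.fourier S w = FourierTransform.fourier H w := by
      rw [SchwartzMap.fourier_coe]
      rfl
    simp_rw [hcoe, Real.fourier_real_eq_integral_exp_smul, smul_eq_mul, hH, Finset.mul_sum]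
    rw [MeasureTheory.integral_finsetSum _ hint, hF, Finset.sum_mul]
    refine Finset.sum_congr rfl fun i _ => ?_
    have h := fourier_comp_mul_sub (fun v => (unitBump v : ℂ)) hT (l i) w
    simp_rw [Real.fourier_real_eq_integral_exp_smul, smul_eq_mul] at h
    simp_rw [mul_left_comm _ (b i)]
    rw [MeasureTheory.integral_const_mul, h, ← mul_assoc]
    congr 4
    push_cast
    ring
  have hplancherel := SchwartzMap.integral_norm_sq_fourier S
  have hSH : ∫ u, ‖S u‖ ^ 2 = ∫ u, ‖H u‖ ^ 2 := rfl
  rw [hSH] at hplancherel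
  have hSint : MeasureTheory.Integrable (fun w => ‖FourierTransform.fourier S w‖ ^ 2) := by
    exact (SchwartzMap.memLp (FourierTransform.fourier S) 2
      MeasureTheory.volume).integrable_norm_pow (by norm_num)
  set c := (2 * Real.pi)⁻¹ * T with hc
  have hcpos : 0 < c := by positivity
  have hsubst : ∫ t in (-T)..T, ‖F t‖ ^ 2 =
      2 * Real.pi * ∫ w in (-c)..c, ‖F (2 * Real.pi * w)‖ ^ 2 := by
    rw [intervalIntegral.integral_comp_mul_left (fun t => ‖F t‖ ^ 2) (by positivity),
      smul_eq_mul, hc]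
    have : 2 * Real.pi * ((2 * Real.pi)⁻¹ * T) = T := by field_simp
    rw [mul_neg, this]
    field_simp
  have hpoint : ∀ w ∈ Set.Icc (-c) c, ‖F (2 * Real.pi * w)‖ ^ 2 ≤
      (2 * T / B) ^ 2 * ‖FourierTransform.fourier S w‖ ^ 2 := by
    intro w hw
    have hwT : |w / T| ≤ 1 / (2 * Real.pi) := by
      rw [abs_div, abs_of_pos hT, div_le_iff₀ hT, one_div]
      exact abs_le.2 hw
    have hlow := integral_unitBump_le_norm_fourier hwT
    rw [← mul_pow]
    gcongr
    rw [hfourier, norm_mul, norm_mul, Complex.norm_real,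
      Real.norm_of_nonneg (inv_nonneg.2 hT.le)]
    calc ‖F (2 * Real.pi * w)‖ = 2 * T / B * (‖F (2 * Real.pi * w)‖ * (T⁻¹ * (B / 2))) := by
          field_simp
      _ ≤ _ := by gcongr
  calc _ = 2 * Real.pi * ∫ w in (-c)..c, ‖F (2 * Real.pi * w)‖ ^ 2 := hsubst
    _ ≤ 2 * Real.pi * ∫ w in (-c)..c, (2 * T / B) ^ 2 * ‖FourierTransform.fourier S w‖ ^ 2 := by
        gcongr
        refine intervalIntegral.integral_mono_on (by linarith) ?_ ?_ hpoint
        · exact Continuous.intervalIntegrable (by fun_prop) _ _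
        · exact (hSint.const_mul _).intervalIntegrable
    _ ≤ 2 * Real.pi * ((2 * T / B) ^ 2 * ∫ u, ‖H u‖ ^ 2) := by
        rw [intervalIntegral.integral_const_mul, ← hplancherel,
          intervalIntegral.integral_of_le (by linarith)]
        have := MeasureTheory.setIntegral_le_integral (s := Set.Ioc (-c) c) hSint
            (Filter.Eventually.of_forall fun _ => by positivity)
        gcongr
    _ = _ := by ring

lemma norm_sum_bump_sq_le {ι : Type*} (s : Finset ι) (a : ι → ℂ) (w K l : ι → ℝ) {T : ℝ}
    (hT : 0 < T) (hw : ∀ i ∈ s, 0 ≤ w i)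
    (hK : ∀ i ∈ s, ∑ j ∈ s.filter (fun j => |l j - l i| ≤ 1 / T), w j ≤ K i) (u : ℝ) :
    ‖∑ i ∈ s, a i * w i * (unitBump (T * (u - l i)) : ℂ)‖ ^ 2 ≤
      ∑ i ∈ s, K i * ‖a i‖ ^ 2 * w i * unitBump (T * (u - l i)) := by
  set f : ι → ℝ := fun i => unitBump (T * (u - l i))
  have hf0 : ∀ i, 0 ≤ f i := fun i => unitBump.nonneg
  have hf1 : ∀ i, f i ≤ 1 := fun i => unitBump.le_one
  have hfz : ∀ i, f i ≠ 0 → |u - l i| ≤ 1 / 2 / T := by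
    intro i hi
    by_contra! h
    refine hi (unitBump_eq_zero ?_)
    rw [div_lt_iff₀ hT] at h
    rw [abs_mul, abs_of_pos hT]
    linarith
  have hnorm : ‖∑ i ∈ s, a i * w i * (f i : ℂ)‖ ≤ ∑ i ∈ s, ‖a i‖ * (w i * f i) := by
    refine (norm_sum_le _ _).trans (Finset.sum_le_sum fun i hi => ?_)
    rw [norm_mul, norm_mul, Complex.norm_real, Complex.norm_real, Real.norm_of_nonneg (hw i hi),
      Real.norm_of_nonneg (hf0 i), mul_assoc]
  calc _ ≤ (∑ i ∈ s, ‖a i‖ * (w i * f i)) ^ 2 := by gcongr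
    _ ≤ (∑ i ∈ s, w i * f i) * ∑ i ∈ s, ‖a i‖ ^ 2 * (w i * f i) := by
        refine Finset.sum_sq_le_sum_mul_sum_of_sq_le_mul _
          (fun i hi => mul_nonneg (hw i hi) (hf0 i))
          (fun i hi => mul_nonneg (by positivity) (mul_nonneg (hw i hi) (hf0 i))) fun i _ => le_of_eq ?_
        ring
    _ ≤ _ := by
        rw [Finset.mul_sum]
        refine Finset.sum_le_sum fun i hi => ?_
        change _ ≤ K i * ‖a i‖ ^ 2 * w i * f i
        by_cases hi0 : f i = 0
        · simp [hi0]
        have hsum : ∑ j ∈ s, w j * f j ≤ K i := by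
          refine le_trans ?_ (hK i hi)
          rw [Finset.sum_filter]
          refine Finset.sum_le_sum fun j hj => ?_
          by_cases hj0 : f j = 0
          · rw [hj0, mul_zero]
            split_ifs
            exacts [hw j hj, le_rfl]
          · rw [if_pos]
            · exact mul_le_of_le_one_right (hw j hj) (hf1 j)
            · have h1 := abs_le.1 (hfz i hi0)
              have h2 := abs_le.1 (hfz j hj0)
              have h3 : 1 / T = 1 / 2 / T + 1 / 2 / T := by ring
              exact abs_le.2 ⟨by linarith, by linarith⟩
        calc _ ≤ K i * (‖a i‖ ^ 2 * (w i * f i)) := by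
              have := mul_nonneg (hw i hi) (hf0 i)
              gcongr
          _ = _ := by ring

/-- A weighted mean value theorem: only frequencies within `1 / T` of each other interact. -/
theorem integral_norm_sq_weighted_expSum_le {ι : Type*} (s : Finset ι) (a : ι → ℂ)
    (w K l : ι → ℝ) {T : ℝ} (hT : 0 < T) (hw : ∀ i ∈ s, 0 ≤ w i)
    (hK : ∀ i ∈ s, ∑ j ∈ s.filter (fun j => |l j - l i| ≤ 1 / T), w j ≤ K i) :
    ∫ t in (-T)..T, ‖∑ i ∈ s, a i * w i * Complex.exp (-((t * l i : ℝ) : ℂ) * Complex.I)‖ ^ 2 ≤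
      8 * Real.pi * T / (∫ v, unitBump v) * ∑ i ∈ s, K i * ‖a i‖ ^ 2 * w i := by
  have hB := integral_unitBump_pos
  have hint : ∀ i, MeasureTheory.Integrable (fun u => unitBump (T * (u - l i))) := fun i =>
    (unitBump.continuous.comp (by fun_prop)).integrable_of_hasCompactSupport
      (hasCompactSupport_unitBump_comp hT (l i))
  have hbump : ∫ u, ‖∑ i ∈ s, a i * w i * (unitBump (T * (u - l i)) : ℂ)‖ ^ 2 ≤
      ∑ i ∈ s, K i * ‖a i‖ ^ 2 * w i * (T⁻¹ * ∫ v, unitBump v) := by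
    rw [Finset.sum_congr rfl fun i _ => by rw [← integral_unitBump_comp hT (l i)]]
    simp_rw [← MeasureTheory.integral_const_mul]
    rw [← MeasureTheory.integral_finsetSum _ fun i _ => (hint i).const_mul _]
    exact MeasureTheory.integral_mono_of_nonneg (Filter.Eventually.of_forall fun _ => by positivity)
      (MeasureTheory.integrable_finsetSum _ fun i _ => (hint i).const_mul _)
      (Filter.Eventually.of_forall (norm_sum_bump_sq_le s a w K l hT hw hK))
  refine (integral_norm_sq_expSum_le s (fun i => a i * w i) l hT).trans ?_
  calc _ ≤ 2 * Real.pi * (2 * T / ∫ v, unitBump v) ^ 2 *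
        ∑ i ∈ s, K i * ‖a i‖ ^ 2 * w i * (T⁻¹ * ∫ v, unitBump v) := by
        have := Real.pi_pos
        gcongr
    _ = _ := by
        rw [← Finset.sum_mul]
        field_simp
        ring

theorem mean_value_dirichlet_polynomials_primes :
    ∃ C : ℝ, 0 < C ∧ ∀ a : ℕ → ℂ, ∀ x T : ℝ, 1 ≤ x → 1 ≤ T →
      (∫ t in (-T)..T,
          ‖∑ n ∈ Finset.Icc ⌈T ^ 2⌉₊ ⌊x⌋₊,
              a n * (ArithmeticFunction.vonMangoldt n : ℂ) *
                (n : ℂ) ^ (-((t : ℂ) * Complex.I))‖ ^ 2) ≤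
        C * ∑ n ∈ Finset.Icc ⌈T ^ 2⌉₊ ⌊x⌋₊,
              (n : ℝ) * ‖a n‖ ^ 2 * ArithmeticFunction.vonMangoldt n := by
  have hB := integral_unitBump_pos
  have hpi := Real.pi_pos
  refine ⟨48960 * Real.pi / ∫ v, unitBump v, by positivity, fun a x T _ hT => ?_⟩
  have hT0 : 0 < T := by linarith
  have hmem : ∀ n ∈ Finset.Icc ⌈T ^ 2⌉₊ ⌊x⌋₊, T ^ 2 ≤ n ∧ 0 < n := by
    intro n hn
    have h : T ^ 2 ≤ n := Nat.ceil_le.1 (Finset.mem_Icc.1 hn).1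
    have hpos : (0 : ℝ) < n := lt_of_lt_of_le (by positivity) h
    exact ⟨h, by exact_mod_cast hpos⟩
  have hmain := integral_norm_sq_weighted_expSum_le (Finset.Icc ⌈T ^ 2⌉₊ ⌊x⌋₊) a
    (fun n => ArithmeticFunction.vonMangoldt n) (fun n => 6120 * (n / T))
    (fun n => Real.log n) hT0 (fun _ _ => ArithmeticFunction.vonMangoldt_nonneg)
    fun n hn => sum_vonMangoldt_window_le hT (hmem n hn).1 _ fun m hm =>
      ⟨(hmem m (Finset.mem_filter.1 hm).1).2, (Finset.mem_filter.1 hm).2⟩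
  have hcpow : ∀ t : ℝ, ∀ n ∈ Finset.Icc ⌈T ^ 2⌉₊ ⌊x⌋₊,
      a n * (ArithmeticFunction.vonMangoldt n : ℂ) * (n : ℂ) ^ (-((t : ℂ) * Complex.I)) =
      a n * (ArithmeticFunction.vonMangoldt n : ℂ) *
        Complex.exp (-((t * Real.log n : ℝ) : ℂ) * Complex.I) := by
    intro t n hn
    rw [Complex.cpow_def_of_ne_zero (by exact_mod_cast (hmem n hn).2.ne'), ← Complex.natCast_log]
    congr 2
    push_cast
    ring
  simp_rw [fun t : ℝ => Finset.sum_congr rfl (hcpow t)]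
  refine hmain.trans_eq ?_
  rw [Finset.mul_sum, Finset.mul_sum]
  refine Finset.sum_congr rfl fun n _ => ?_
  field_simp
  ring
end
end

section
/- Lower bound limiting Halász's theorem (Lemma 2.7): There is an absolute constant c > 0 such that for every κ > 0, every f in the class C(κ), every real σ with 0 < σ ≤ 1, and every real T with T ≥ 4·ζ(1+σ)^{κ/2}, one has max_{|t| ≤ T} |F(1+σ+it)| / |1+σ+it| ≥ c, where ζ is the Riemann zeta function. -/
open Complex MeasureTheory
open scoped Classical

noncomputable section

/-- Membership of `f` in the class `C(κ)`, witnessed by `Λf`. -/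
structure IsHalaszClass (κ : ℝ) (f : ℕ → ℂ) (Λf : ℕ → ℂ) : Prop where
  map_one : f 1 = 1
  mult : ∀ m n : ℕ, Nat.Coprime m n → f (m * n) = f m * f n
  supp : ∀ n : ℕ, ¬ IsPrimePow n → Λf n = 0
  bound : ∀ n : ℕ, 1 ≤ n → ‖Λf n‖ ≤ κ * ArithmeticFunction.vonMangoldt n
  conv : ∀ n : ℕ, 1 ≤ n →
    f n * (Real.log n : ℂ) = ∑ d ∈ n.divisors, Λf d * f (n / d)
  abs_conv : ∀ σ : ℝ, 1 < σ → Summable (fun n : ℕ => ‖f n‖ / (n : ℝ) ^ σ)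

/-- The Dirichlet series `F(s) = ∑ f(n) n^{-s}`. -/
def Fser (f : ℕ → ℂ) (s : ℂ) : ℂ := ∑' n : ℕ, f n / (n : ℂ) ^ s

section AbsoluteBound

open LSeries Filter Topology
open scoped ComplexOrder

/-- The Dirichlet series of `f` in absolute values, as a real function. -/
def absSer (f : ℕ → ℂ) (x : ℝ) : ℝ := (LSeries (fun n => (‖f n‖ : ℂ)) x).re

namespace IsHalaszClass

variable {κ : ℝ} {f Λf : ℕ → ℂ}

lemma lseriesSummable_norm (h : IsHalaszClass κ f Λf) {x : ℝ} (hx : 1 < x) :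
    LSeriesSummable (fun n => (‖f n‖ : ℂ)) x := by
  rw [LSeriesSummable, ← summable_norm_iff]
  refine (h.abs_conv x hx).of_nonneg_of_le (fun _ => norm_nonneg _) fun n => ?_
  rw [norm_term_eq]
  split_ifs
  · positivity
  · simp

lemma abscissaOfAbsConv_norm_lt (h : IsHalaszClass κ f Λf) {x : ℝ} (hx : 1 < x) :
    abscissaOfAbsConv (fun n => (‖f n‖ : ℂ)) < x :=
  (abscissaOfAbsConv_le_of_forall_lt_LSeriesSummable (x := 1)
    fun _ hy => h.lseriesSummable_norm hy).trans_lt (by exact_mod_cast hx)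

lemma logMul_norm_le (h : IsHalaszClass κ f Λf) {n : ℕ} (hn : n ≠ 0) :
    ‖f n‖ * Real.log n ≤
      ∑ d ∈ n.divisors, κ * ArithmeticFunction.vonMangoldt d * ‖f (n / d)‖ := by
  have h1 : 1 ≤ n := Nat.one_le_iff_ne_zero.2 hn
  have hc := congrArg norm (h.conv n h1)
  rw [norm_mul, Complex.norm_real, Real.norm_of_nonneg (Real.log_natCast_nonneg n)] at hc
  rw [hc]
  refine (norm_sum_le _ _).trans (Finset.sum_le_sum fun d hd => ?_)
  rw [norm_mul]
  exact mul_le_mul_of_nonneg_right (h.bound d (Nat.pos_of_mem_divisors hd)) (norm_nonneg _)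

/-- The Dirichlet series inequality `-G' ≤ κ (-ζ'/ζ) G` for `G = ∑ |f(n)| n⁻ˢ`. -/
lemma lseries_logMul_norm_le (h : IsHalaszClass κ f Λf) {x : ℝ} (hx : 1 < x) :
    (LSeries (logMul fun n => (‖f n‖ : ℂ)) x).re ≤
      κ * (LSeries (fun n => (ArithmeticFunction.vonMangoldt n : ℂ)) x).re * absSer f x := by
  have hsg := h.lseriesSummable_norm hx
  have hsΛ : LSeriesSummable (fun n => (ArithmeticFunction.vonMangoldt n : ℂ)) x :=
    ArithmeticFunction.LSeriesSummable_vonMangoldt (by simpa using hx)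
  have hslog : LSeriesSummable (logMul fun n => (‖f n‖ : ℂ)) x :=
    LSeriesSummable_logMul_of_lt_re (by simpa using h.abscissaOfAbsConv_norm_lt hx)
  have hposg : 0 < LSeries (fun n => (‖f n‖ : ℂ)) x :=
    LSeries.positive (fun n => by simp) (by simp [h.map_one]) (h.abscissaOfAbsConv_norm_lt hx)
  have himg : (LSeries (fun n => (‖f n‖ : ℂ)) x).im = 0 := (Complex.lt_def.1 hposg).2.symm
  have hconv := LSeries_convolution' hsΛ hsg
  have hsconv := (hsΛ.convolution hsg)
  have hre := congrArg Complex.re hconv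
  rw [Complex.mul_re, himg, mul_zero, sub_zero] at hre
  rw [absSer, mul_assoc, ← hre, LSeries, LSeries, Complex.re_tsum hslog, Complex.re_tsum hsconv,
    ← tsum_mul_left]
  refine (Complex.hasSum_re hslog.hasSum).summable.tsum_le_tsum (fun n => ?_)
    ((Complex.hasSum_re hsconv.hasSum).summable.mul_left κ)
  rcases eq_or_ne n 0 with rfl | hn
  · simp
  have hterm : ∀ r : ℝ, ((r : ℂ) / (n : ℂ) ^ (x : ℂ)).re = r / (n : ℝ) ^ x := fun r => by
    rw [← Complex.ofReal_natCast, ← Complex.ofReal_cpow n.cast_nonneg, ← Complex.ofReal_div,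
      Complex.ofReal_re]
  have e1 : logMul (fun n => (‖f n‖ : ℂ)) n = ((‖f n‖ * Real.log n : ℝ) : ℂ) := by
    simp [logMul, mul_comm, Complex.natCast_log]
  have e2 : LSeries.convolution (fun n => (ArithmeticFunction.vonMangoldt n : ℂ))
      (fun n => (‖f n‖ : ℂ)) n =
      ((∑ d ∈ n.divisors, ArithmeticFunction.vonMangoldt d * ‖f (n / d)‖ : ℝ) : ℂ) := by
    rw [LSeries.convolution_def]
    beta_reduce
    rw [Nat.sum_divisorsAntidiagonal (fun a b => (ArithmeticFunction.vonMangoldt a : ℂ) * (‖f b‖ : ℂ))]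
    push_cast
    rfl
  rw [term_of_ne_zero hn, term_of_ne_zero hn, e1, e2, hterm, hterm, ← mul_div_assoc,
    Finset.mul_sum]
  refine div_le_div_of_nonneg_right ?_ (by positivity)
  simpa only [mul_assoc] using h.logMul_norm_le hn

lemma absSer_pos (h : IsHalaszClass κ f Λf) {x : ℝ} (hx : 1 < x) : 0 < absSer f x :=
  (Complex.lt_def.1 (LSeries.positive (fun n => by simp) (by simp [h.map_one])
    (h.abscissaOfAbsConv_norm_lt hx))).1

lemma hasDerivAt_absSer (h : IsHalaszClass κ f Λf) {x : ℝ} (hx : 1 < x) :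
    HasDerivAt (absSer f) (-(LSeries (logMul fun n => (‖f n‖ : ℂ)) x).re) x :=
  (LSeries_hasDerivAt (s := x) (by simpa using h.abscissaOfAbsConv_norm_lt hx)).real_of_complex

lemma tendsto_absSer (h : IsHalaszClass κ f Λf) : Tendsto (absSer f) atTop (𝓝 1) := by
  have h2 := LSeries.tendsto_atTop (f := fun n => (‖f n‖ : ℂ))
    ((h.abscissaOfAbsConv_norm_lt one_lt_two).trans (EReal.coe_lt_top _))
  have h3 := (Complex.continuous_re.tendsto _).comp h2
  simp only [h.map_one, norm_one, Complex.ofReal_one, Complex.one_re] at h3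
  exact h3

end IsHalaszClass

lemma zeta_re_pos {x : ℝ} (hx : 1 < x) : 0 < (riemannZeta x).re := by
  rw [← LSeries_one_eq_riemannZeta (by simpa using hx)]
  exact (Complex.lt_def.1 (LSeries.positive (fun n => by simp) (by simp)
    (by rw [abscissaOfAbsConv_one]; exact_mod_cast hx))).1

lemma zeta_im_eq_zero {x : ℝ} (hx : 1 < x) : (riemannZeta x).im = 0 := by
  rw [← LSeries_one_eq_riemannZeta (by simpa using hx)]
  exact (Complex.lt_def.1 (LSeries.positive (fun n => by simp) (by simp)
    (by rw [abscissaOfAbsConv_one]; exact_mod_cast hx))).2.symm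

lemma hasDerivAt_zeta_re {x : ℝ} (hx : 1 < x) :
    HasDerivAt (fun y : ℝ => (riemannZeta y).re)
      (-((LSeries (fun n => (ArithmeticFunction.vonMangoldt n : ℂ)) x).re * (riemannZeta x).re))
      x := by
  have hd : DifferentiableAt ℂ riemannZeta x :=
    differentiableAt_riemannZeta (by exact_mod_cast hx.ne')
  have hne : riemannZeta x ≠ 0 := fun h0 => (zeta_re_pos hx).ne' (by simp [h0])
  have hΛ := ArithmeticFunction.LSeries_vonMangoldt_eq_deriv_riemannZeta_div (s := x)
    (by simpa using hx)
  have hderiv : deriv riemannZeta x =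
      -(LSeries (fun n => (ArithmeticFunction.vonMangoldt n : ℂ)) x * riemannZeta x) := by
    rw [hΛ]
    field_simp
  convert hd.hasDerivAt.real_of_complex using 1
  rw [hderiv, Complex.neg_re, Complex.mul_re, zeta_im_eq_zero hx, mul_zero, sub_zero]

lemma tendsto_zeta_re : Tendsto (fun x : ℝ => (riemannZeta x).re) atTop (𝓝 1) := by
  have h2 := LSeries.tendsto_atTop (f := 1) (by rw [abscissaOfAbsConv_one]; exact EReal.coe_lt_top 1)
  have h3 := (Complex.continuous_re.tendsto _).comp h2
  simp only [Pi.one_apply, Complex.one_re] at h3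
  refine h3.congr' ?_
  filter_upwards [eventually_gt_atTop 1] with x hx
  simp [LSeries_one_eq_riemannZeta (s := x) (by simpa using hx)]

/-- `∑ |f(n)| n⁻ˣ ≤ ζ(x)^κ` for `f` in the class `C(κ)`. -/
lemma IsHalaszClass.absSer_le {κ : ℝ} {f Λf : ℕ → ℂ} (h : IsHalaszClass κ f Λf) {x : ℝ}
    (hx : 1 < x) : absSer f x ≤ (riemannZeta x).re ^ κ := by
  let D : ℝ → ℝ := fun y => Real.log (absSer f y) - κ * Real.log (riemannZeta y).re
  have hD : ∀ y : ℝ, 1 < y → HasDerivAt D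
      (-(LSeries (logMul fun n => (‖f n‖ : ℂ)) y).re / absSer f y -
        κ * (-((LSeries (fun n => (ArithmeticFunction.vonMangoldt n : ℂ)) y).re *
          (riemannZeta y).re) / (riemannZeta y).re)) y := fun y hy =>
    ((h.hasDerivAt_absSer hy).log (h.absSer_pos hy).ne').sub
      (((hasDerivAt_zeta_re hy).log (zeta_re_pos hy).ne').const_mul κ)
  have hmono : MonotoneOn D (Set.Ioi 1) := by
    refine monotoneOn_of_deriv_nonneg (convex_Ioi 1)
      (fun y hy => (hD y hy).continuousAt.continuousWithinAt)
      (fun y hy => (hD y (interior_subset hy)).differentiableAt.differentiableWithinAt)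
      fun y hy => ?_
    have hy : 1 < y := interior_subset hy
    rw [(hD y hy).deriv, neg_div, neg_div, mul_div_cancel_right₀ _ (zeta_re_pos hy).ne']
    have := (div_le_iff₀ (h.absSer_pos hy)).2 (h.lseries_logMul_norm_le hy)
    linarith
  have hlim : Tendsto D atTop (𝓝 0) := by
    simpa using (h.tendsto_absSer.log one_ne_zero).sub
      ((tendsto_zeta_re.log one_ne_zero).const_mul κ)
  have hle : D x ≤ 0 := by
    refine ge_of_tendsto hlim ?_
    filter_upwards [eventually_ge_atTop x] with y hy
    exact hmono hx (hx.trans_le hy) hy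
  rw [← Real.log_le_log_iff (h.absSer_pos hx) (Real.rpow_pos_of_pos (zeta_re_pos hx) κ),
    Real.log_rpow (zeta_re_pos hx)]
  simpa [D] using hle

end AbsoluteBound

section PerronKernel

open Set Filter

/-- The truncated power `(1 - x)₊ ^ 2`. -/
def truncSq (x : ℝ) : ℂ := ((max (1 - x) 0 ^ 2 : ℝ) : ℂ)

/-- The Mellin transform of `truncSq`. -/
def perronKernel (s : ℂ) : ℂ := 2 / (s * (s + 1) * (s + 2))

lemma continuous_truncSq : Continuous truncSq := by
  unfold truncSq
  fun_prop

lemma truncSq_of_one_le {x : ℝ} (hx : 1 ≤ x) : truncSq x = 0 := by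
  simp [truncSq, max_eq_right (sub_nonpos.2 hx)]

lemma truncSq_of_le_one {x : ℝ} (hx : x ≤ 1) : truncSq x = (1 - (x : ℂ)) ^ (2 + 1 - 1 : ℂ) := by
  rw [truncSq, max_eq_left (sub_nonneg.2 hx), add_sub_cancel_right]
  norm_cast

lemma mellinConvergent_truncSq {s : ℂ} (hs : 0 < s.re) : MellinConvergent truncSq s := by
  rw [MellinConvergent, ← Ioc_union_Ioi_eq_Ioi zero_le_one, integrableOn_union]
  constructor
  · have h := betaIntegral_convergent hs (v := 2 + 1) (by norm_num)
    rw [intervalIntegrable_iff_integrableOn_Ioc_of_le zero_le_one] at h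
    refine h.congr_fun (fun x hx => ?_) measurableSet_Ioc
    simp only [smul_eq_mul, truncSq_of_le_one hx.2]
  · refine integrableOn_zero.congr_fun (fun x hx => ?_) measurableSet_Ioi
    simp [truncSq_of_one_le (mem_Ioi.1 hx).le]

lemma mellin_truncSq {s : ℂ} (hs : 0 < s.re) : mellin truncSq s = perronKernel s := by
  have hb := betaIntegral_eval_nat_add_one_right hs 2
  have hK : betaIntegral s (2 + 1) = perronKernel s := by
    rw [perronKernel]
    simpa [Finset.prod_range_succ, Nat.factorial] using hb
  rw [← hK, betaIntegral, intervalIntegral.integral_of_le zero_le_one, mellin]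
  rw [setIntegral_eq_of_subset_of_forall_sdiff_eq_zero (t := Ioi (0 : ℝ)) (s := Ioc (0 : ℝ) 1)
    measurableSet_Ioi Ioc_subset_Ioi_self]
  · refine setIntegral_congr_fun measurableSet_Ioc fun x hx => ?_
    simp only [smul_eq_mul, truncSq_of_le_one hx.2]
  · intro x hx
    have : 1 ≤ x := by
      by_contra! h
      exact hx.2 ⟨hx.1, h.le⟩
    simp [truncSq_of_one_le this]

variable {c : ℝ}

lemma abs_le_norm_add_mul_I (a t : ℝ) : |t| ≤ ‖(a : ℂ) + t * I‖ := by
  simpa using Complex.abs_im_le_norm ((a : ℂ) + t * I)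

lemma le_norm_add_mul_I (a t : ℝ) : a ≤ ‖(a : ℂ) + t * I‖ := by
  simpa using (le_abs_self _).trans (Complex.abs_re_le_norm ((a : ℂ) + t * I))

lemma sqrt_one_add_sq_le_norm {a : ℝ} (ha : 1 ≤ a) (t : ℝ) :
    √(1 + t ^ 2) ≤ ‖(a : ℂ) + t * I‖ := by
  rw [Complex.norm_add_mul_I]
  exact Real.sqrt_le_sqrt (by nlinarith)

lemma norm_perronKernel (s : ℂ) :
    ‖perronKernel s‖ = 2 / (‖s‖ * ‖s + 1‖ * ‖s + 2‖) := by
  simp [perronKernel]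

/-- Quadratic decay of the kernel on vertical lines, keeping the factor `1 / ‖s‖`. -/
lemma norm_perronKernel_le (hc : 1 ≤ c) (t : ℝ) :
    ‖perronKernel (c + t * I)‖ ≤ 2 / ‖(c : ℂ) + t * I‖ * (1 + t ^ 2)⁻¹ := by
  have h1 := sqrt_one_add_sq_le_norm (a := c + 1) (by linarith) t
  have h2 := sqrt_one_add_sq_le_norm (a := c + 2) (by linarith) t
  have e1 : (c : ℂ) + t * I + 1 = ((c + 1 : ℝ) : ℂ) + t * I := by push_cast; ring
  have e2 : (c : ℂ) + t * I + 2 = ((c + 2 : ℝ) : ℂ) + t * I := by push_cast; ring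
  have h0 : 0 < ‖(c : ℂ) + t * I‖ := by linarith [le_norm_add_mul_I c t]
  have h3 : 1 + t ^ 2 ≤ ‖(c : ℂ) + t * I + 1‖ * ‖(c : ℂ) + t * I + 2‖ := by
    rw [e1, e2, ← Real.mul_self_sqrt (show 0 ≤ 1 + t ^ 2 by positivity)]
    exact mul_le_mul h1 h2 (Real.sqrt_nonneg _) (norm_nonneg _)
  rw [norm_perronKernel, mul_assoc, ← div_div, ← div_eq_mul_inv]
  exact div_le_div_of_nonneg_left (by positivity) (by positivity) h3

/-- Cubic decay of the kernel on vertical lines. -/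
lemma norm_perronKernel_le_rpow (c : ℝ) {t : ℝ} (ht : 0 < |t|) :
    ‖perronKernel (c + t * I)‖ ≤ 2 * |t| ^ (-3 : ℝ) := by
  have h0 := abs_le_norm_add_mul_I c t
  have h1 := abs_le_norm_add_mul_I (c + 1) t
  have h2 := abs_le_norm_add_mul_I (c + 2) t
  have e1 : (c : ℂ) + t * I + 1 = ((c + 1 : ℝ) : ℂ) + t * I := by push_cast; ring
  have e2 : (c : ℂ) + t * I + 2 = ((c + 2 : ℝ) : ℂ) + t * I := by push_cast; ring
  have e3 : |t| ^ (-3 : ℝ) = (|t| * |t| * |t|)⁻¹ := by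
    rw [Real.rpow_neg ht.le, show (3 : ℝ) = (3 : ℕ) by norm_num, Real.rpow_natCast, pow_three']
  rw [norm_perronKernel, e1, e2, e3, ← div_eq_mul_inv]
  gcongr

lemma continuous_perronKernel_line (hc : 1 ≤ c) :
    Continuous fun t : ℝ => perronKernel (c + t * I) := by
  have hne : ∀ (a : ℝ), 0 ≤ a → ∀ t : ℝ, (c : ℂ) + t * I + a ≠ 0 := fun a ha t h0 => by
    have := congrArg Complex.re h0
    simp at this
    linarith
  refine Continuous.div (by fun_prop) (by fun_prop) fun t => ?_
  have h0 := hne 0 le_rfl t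
  have h1 := hne 1 zero_le_one t
  have h2 := hne 2 zero_le_two t
  push_cast at h0 h1 h2
  rw [add_zero] at h0
  exact mul_ne_zero (mul_ne_zero h0 h1) h2

lemma integrable_perronKernel_line (hc : 1 ≤ c) :
    Integrable fun t : ℝ => perronKernel (c + t * I) := by
  refine (integrable_inv_one_add_sq.const_mul 2).mono'
    (continuous_perronKernel_line hc).aestronglyMeasurable (ae_of_all _ fun t => ?_)
  refine (norm_perronKernel_le hc t).trans ?_
  have h0 : 1 ≤ ‖(c : ℂ) + t * I‖ := hc.trans (le_norm_add_mul_I c t)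
  gcongr
  exact div_le_self zero_le_two h0

/-- Perron's formula with the kernel `perronKernel`. -/
lemma integral_cpow_mul_perronKernel (hc : 1 ≤ c) {x : ℝ} (hx : 0 < x) :
    ∫ t : ℝ, (x : ℂ) ^ (-(c + t * I)) * perronKernel (c + t * I) = 2 * Real.pi * truncSq x := by
  have hmel : ∀ t : ℝ, mellin truncSq (c + t * I) = perronKernel (c + t * I) := fun t =>
    mellin_truncSq (by simp; linarith)
  have h := mellinInv_mellin_eq c truncSq hx
    (mellinConvergent_truncSq (by simp; linarith))
    (by
      rw [VerticalIntegrable]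
      simpa only [hmel] using integrable_perronKernel_line hc)
    continuous_truncSq.continuousAt
  rw [mellinInv] at h
  simp only [hmel, smul_eq_mul] at h
  generalize ∫ t : ℝ, (x : ℂ) ^ (-(c + t * I)) * perronKernel (c + t * I) = J at h ⊢
  rw [← h, Complex.real_smul]
  push_cast
  field_simp

end PerronKernel

section PerronFormula

variable {f : ℕ → ℂ} {c : ℝ}

lemma norm_div_natCast_cpow_line (hc : 1 ≤ c) (n : ℕ) (t : ℝ) :
    ‖f n / (n : ℂ) ^ ((c : ℂ) + t * I)‖ = ‖f n‖ / (n : ℝ) ^ c := by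
  rw [norm_div]
  congr 1
  simpa using Complex.norm_natCast_cpow_of_re_ne_zero n (s := (c : ℂ) + t * I)
    (by simp; linarith)

lemma norm_Fser_le (hc : 1 ≤ c) (hf : Summable fun n : ℕ => ‖f n‖ / (n : ℝ) ^ c) (t : ℝ) :
    ‖Fser f (c + t * I)‖ ≤ ∑' n : ℕ, ‖f n‖ / (n : ℝ) ^ c :=
  tsum_of_norm_bounded hf.hasSum fun n => (norm_div_natCast_cpow_line hc n t).le

/-- Only the first coefficient contributes to the Perron integral at height `2`. -/
lemma integral_Fser_mul_perronKernel (hc : 1 ≤ c)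
    (hf : Summable fun n : ℕ => ‖f n‖ / (n : ℝ) ^ c) :
    ∫ t : ℝ, Fser f (c + t * I) * ((2 : ℂ) ^ (c + t * I) * perronKernel (c + t * I)) =
      f 1 * (Real.pi / 2) := by
  set g : ℝ → ℂ := fun t => (2 : ℂ) ^ (c + t * I) * perronKernel (c + t * I) with hg
  have hline : Continuous fun t : ℝ => (c : ℂ) + t * I := by fun_prop
  have hre : ∀ t : ℝ, ((c : ℂ) + t * I).re = c := fun t => by simp
  have hs : ∀ t : ℝ, (c : ℂ) + t * I ≠ 0 := fun t h0 => by
    have := hre t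
    rw [h0, Complex.zero_re] at this
    linarith
  have hgi : Integrable g := by
    refine (integrable_perronKernel_line hc).bdd_mul (c := (2 : ℝ) ^ c)
      (hline.const_cpow (Or.inl two_ne_zero)).aestronglyMeasurable (ae_of_all _ fun t => ?_)
    have e := Complex.norm_cpow_eq_rpow_re_of_pos two_pos ((c : ℂ) + t * I)
    rw [hre t, Complex.ofReal_ofNat] at e
    exact e.le
  have hmeas : ∀ n : ℕ, Continuous fun t : ℝ => f n / (n : ℂ) ^ ((c : ℂ) + t * I) := fun n => by
    rcases eq_or_ne n 0 with rfl | hn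
    · simpa [Complex.zero_cpow (hs _)] using continuous_const
    · exact continuous_const.div (hline.const_cpow (Or.inl (by exact_mod_cast hn)))
        fun t => by simp [Complex.cpow_eq_zero_iff, hn]
  have hint : ∀ n : ℕ, Integrable fun t : ℝ => f n / (n : ℂ) ^ ((c : ℂ) + t * I) * g t := fun n =>
    hgi.bdd_mul (hmeas n).aestronglyMeasurable
      (ae_of_all _ fun t => (norm_div_natCast_cpow_line hc n t).le)
  have hsum := hasSum_integral_of_summable_integral_norm hint (by
    simp only [norm_mul, norm_div_natCast_cpow_line hc, integral_const_mul]
    exact hf.mul_right _)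
  have hterm : ∀ n : ℕ, ∫ t : ℝ, f n / (n : ℂ) ^ ((c : ℂ) + t * I) * g t =
      if n = 1 then f 1 * (Real.pi / 2) else 0 := fun n => by
    rcases eq_or_ne n 0 with rfl | hn
    · simp [Complex.zero_cpow (hs _)]
    have hx : (0 : ℝ) < n / 2 := by positivity
    have hpow : ∀ s : ℂ, f n / (n : ℂ) ^ s * ((2 : ℂ) ^ s * perronKernel s) =
        f n * ((((n : ℝ) / 2 : ℝ) : ℂ) ^ (-s) * perronKernel s) := fun s => by
      have h2 : (((n : ℝ) / 2 : ℝ) : ℂ) ^ s * (2 : ℂ) ^ s = (n : ℂ) ^ s := by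
        have := Complex.mul_cpow_ofReal_nonneg hx.le (zero_le_two (α := ℝ)) s
        rw [← Complex.ofReal_mul, div_mul_cancel₀ _ two_ne_zero] at this
        simpa using this.symm
      have hne : (((n : ℝ) / 2 : ℝ) : ℂ) ^ s ≠ 0 := by
        simp [Complex.cpow_eq_zero_iff, hn]
      have hne2 : (2 : ℂ) ^ s ≠ 0 := by simp [Complex.cpow_eq_zero_iff]
      rw [← h2, Complex.cpow_neg]
      field_simp
    simp only [hg, hpow]
    rw [integral_const_mul, integral_cpow_mul_perronKernel hc hx]
    split_ifs with h1
    · subst h1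
      have : truncSq ((1 : ℕ) / 2) = 1 / 4 := by
        rw [truncSq, max_eq_left (by norm_num)]
        norm_num
      rw [this]
      ring
    · have h2 : (2 : ℝ) ≤ n := by exact_mod_cast (by omega : 2 ≤ n)
      rw [truncSq_of_one_le (by linarith)]
      simp
  simp only [hterm, tsum_mul_right] at hsum
  exact hsum.unique (hasSum_ite_eq 1 _)

end PerronFormula

/-- Upper bound for the Perron integral, from a bound for `F(s) / s` on `|t| ≤ T` and a uniform
bound for `F`. -/
lemma pi_div_two_le_of_bounds {f : ℕ → ℂ} {c M B T : ℝ} (hc : 1 ≤ c) (hc2 : c ≤ 2) (hT : 0 < T)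
    (h1 : f 1 = 1) (hf : Summable fun n : ℕ => ‖f n‖ / (n : ℝ) ^ c)
    (hM : ∀ t : ℝ, |t| ≤ T → ‖Fser f (c + t * I)‖ / ‖(c : ℂ) + t * I‖ ≤ M)
    (hB : ∀ t : ℝ, ‖Fser f (c + t * I)‖ ≤ B) :
    Real.pi / 2 ≤ 8 * M * Real.pi + 8 * B / T ^ 2 := by
  set h : ℝ → ℝ := (Set.Ioi T).indicator fun t => t ^ (-3 : ℝ) with hh
  have hM0 : 0 ≤ M := (by positivity : (0 : ℝ) ≤ _).trans (hM 0 (by simpa using hT.le))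
  have hB0 : 0 ≤ B := (norm_nonneg _).trans (hB 0)
  have hhi : Integrable h :=
    (integrableOn_Ioi_rpow_of_lt (by norm_num) hT).integrable_indicator measurableSet_Ioi
  have hh0 : ∀ t, 0 ≤ h t := fun t =>
    Set.indicator_nonneg (fun u hu => Real.rpow_nonneg (hT.trans hu).le _) t
  have hhint : ∫ t, h t = 1 / (2 * T ^ 2) := by
    rw [hh, integral_indicator measurableSet_Ioi, integral_Ioi_rpow_of_lt (by norm_num) hT,
      show (-3 + 1 : ℝ) = -(2 : ℕ) by norm_num, Real.rpow_neg hT.le, Real.rpow_natCast]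
    field_simp
    norm_num
  have hpt : ∀ t : ℝ,
      ‖Fser f (c + t * I) * ((2 : ℂ) ^ (c + t * I) * perronKernel (c + t * I))‖ ≤
        8 * M * (1 + t ^ 2)⁻¹ + 8 * B * (h t + h (-t)) := fun t => by
    have h2 : ‖(2 : ℂ) ^ ((c : ℂ) + t * I)‖ ≤ 4 := by
      have e := Complex.norm_cpow_eq_rpow_re_of_pos two_pos ((c : ℂ) + t * I)
      rw [Complex.ofReal_ofNat] at e
      rw [e]
      calc (2 : ℝ) ^ ((c : ℂ) + t * I).re ≤ 2 ^ (2 : ℝ) :=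
            Real.rpow_le_rpow_of_exponent_le one_le_two (by simpa using hc2)
        _ = 4 := by norm_num
    have hred : ‖Fser f (c + t * I) * ((2 : ℂ) ^ (c + t * I) * perronKernel (c + t * I))‖ ≤
        4 * (‖Fser f (c + t * I)‖ * ‖perronKernel (c + t * I)‖) := by
      rw [norm_mul, norm_mul, mul_left_comm]
      gcongr
    refine hred.trans ?_
    rcases le_or_gt |t| T with ht | ht
    · have hk := norm_perronKernel_le hc t
      have : ‖Fser f (c + t * I)‖ * ‖perronKernel (c + t * I)‖ ≤ 2 * M * (1 + t ^ 2)⁻¹ :=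
        calc _ ≤ ‖Fser f (c + t * I)‖ * (2 / ‖(c : ℂ) + t * I‖ * (1 + t ^ 2)⁻¹) := by gcongr
          _ = 2 * (‖Fser f (c + t * I)‖ / ‖(c : ℂ) + t * I‖) * (1 + t ^ 2)⁻¹ := by ring
          _ ≤ _ := by gcongr; exact hM t ht
      have := mul_nonneg hB0 (add_nonneg (hh0 t) (hh0 (-t)))
      linarith
    · have hk := norm_perronKernel_le_rpow c (hT.trans ht)
      have htail : |t| ^ (-3 : ℝ) ≤ h t + h (-t) := by
        rcases abs_cases t with ⟨ha, _⟩ | ⟨ha, _⟩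
        · have : h t = |t| ^ (-3 : ℝ) := by
            rw [ha] at ht ⊢
            exact Set.indicator_of_mem (Set.mem_Ioi.2 ht) _
          linarith [hh0 (-t)]
        · have : h (-t) = |t| ^ (-3 : ℝ) := by
            rw [ha] at ht ⊢
            exact Set.indicator_of_mem (Set.mem_Ioi.2 ht) _
          linarith [hh0 t]
      have : ‖Fser f (c + t * I)‖ * ‖perronKernel (c + t * I)‖ ≤ B * (2 * (h t + h (-t))) :=
        mul_le_mul (hB t) (hk.trans (by gcongr)) (norm_nonneg _) hB0
      have : 0 ≤ 8 * M * (1 + t ^ 2)⁻¹ := by positivity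
      linarith
  have hi1 : Integrable fun t : ℝ => 8 * M * (1 + t ^ 2)⁻¹ :=
    integrable_inv_one_add_sq.const_mul _
  have hi2 : Integrable fun t : ℝ => 8 * B * (h t + h (-t)) :=
    (hhi.add hhi.comp_neg).const_mul _
  have hle := norm_integral_le_of_norm_le (hi1.add hi2) (ae_of_all _ hpt)
  rw [integral_Fser_mul_perronKernel hc hf, h1] at hle
  simp only [Pi.add_apply] at hle
  rw [integral_add hi1 hi2, integral_const_mul, integral_const_mul, integral_add hhi hhi.comp_neg,
    integral_neg_eq_self h, hhint, integral_univ_inv_one_add_sq] at hle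
  have hn : ‖(1 : ℂ) * (Real.pi / 2)‖ = Real.pi / 2 := by
    simp [abs_of_pos Real.pi_pos]
  rw [hn] at hle
  refine hle.trans (le_of_eq ?_)
  field_simp
  ring

lemma IsHalaszClass.tsum_norm_le {κ : ℝ} {f Λf : ℕ → ℂ} (h : IsHalaszClass κ f Λf) {x : ℝ}
    (hx : 1 < x) : ∑' n : ℕ, ‖f n‖ / (n : ℝ) ^ x ≤ (riemannZeta x).re ^ κ := by
  refine le_of_eq_of_le ?_ (h.absSer_le hx)
  rw [absSer, LSeries, Complex.re_tsum (h.lseriesSummable_norm hx)]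
  refine tsum_congr fun n => ?_
  rcases eq_or_ne n 0 with rfl | hn
  · simp [Real.zero_rpow (by linarith : x ≠ 0)]
  · rw [LSeries.term_of_ne_zero hn, ← Complex.ofReal_natCast,
      ← Complex.ofReal_cpow n.cast_nonneg, ← Complex.ofReal_div, Complex.ofReal_re]

theorem halasz_lower_bound_limit :
    ∃ c : ℝ, 0 < c ∧ ∀ κ : ℝ, 0 < κ → ∀ f Λf : ℕ → ℂ, IsHalaszClass κ f Λf →
    ∀ σ : ℝ, 0 < σ → σ ≤ 1 →
    ∀ T : ℝ, 4 * ‖riemannZeta ((1 + σ : ℝ) : ℂ)‖ ^ (κ / 2) ≤ T →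
      c ≤ ⨆ t : {t : ℝ // |t| ≤ T},
            ‖Fser f (((1 + σ : ℝ) : ℂ) + ((t : ℝ) : ℂ) * Complex.I)‖ /
              ‖((1 + σ : ℝ) : ℂ) + ((t : ℝ) : ℂ) * Complex.I‖ := by
  refine ⟨1 / 32, by norm_num, fun κ hκ f Λf h σ hσ hσ1 T hT => ?_⟩
  have hx : 1 < 1 + σ := by linarith
  have hz : 0 < ‖riemannZeta ((1 + σ : ℝ) : ℂ)‖ :=
    (zeta_re_pos hx).trans_le (Complex.re_le_norm _)
  have hT0 : 0 < T := (by positivity : (0 : ℝ) < _).trans_le hT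
  have hsum := h.abs_conv (1 + σ) hx
  set B : ℝ := ∑' n : ℕ, ‖f n‖ / (n : ℝ) ^ (1 + σ) with hBdef
  have hB : ∀ t : ℝ, ‖Fser f (((1 + σ : ℝ) : ℂ) + t * I)‖ ≤ B := norm_Fser_le hx.le hsum
  have hB0 : 0 ≤ B := (norm_nonneg _).trans (hB 0)
  have hBT : 16 * B ≤ T ^ 2 := by
    have h1 : B ≤ ‖riemannZeta ((1 + σ : ℝ) : ℂ)‖ ^ κ := (h.tsum_norm_le hx).trans
      (Real.rpow_le_rpow (zeta_re_pos hx).le (Complex.re_le_norm _) hκ.le)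
    have h2 : (‖riemannZeta ((1 + σ : ℝ) : ℂ)‖ ^ (κ / 2)) ^ 2 =
        ‖riemannZeta ((1 + σ : ℝ) : ℂ)‖ ^ κ := by
      rw [← Real.rpow_mul_natCast hz.le]
      congr 1
      push_cast
      ring
    have h3 := pow_le_pow_left₀ (by positivity) hT 2
    rw [mul_pow, h2] at h3
    linarith
  have hbdd : BddAbove (Set.range fun t : {t : ℝ // |t| ≤ T} =>
      ‖Fser f (((1 + σ : ℝ) : ℂ) + ((t : ℝ) : ℂ) * Complex.I)‖ /
        ‖((1 + σ : ℝ) : ℂ) + ((t : ℝ) : ℂ) * Complex.I‖) := by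
    refine ⟨B, ?_⟩
    rintro _ ⟨t, rfl⟩
    exact (div_le_self (norm_nonneg _) (hx.le.trans (le_norm_add_mul_I _ _))).trans (hB t)
  set M := ⨆ t : {t : ℝ // |t| ≤ T}, ‖Fser f (((1 + σ : ℝ) : ℂ) + ((t : ℝ) : ℂ) * Complex.I)‖ /
    ‖((1 + σ : ℝ) : ℂ) + ((t : ℝ) : ℂ) * Complex.I‖ with hMdef
  have key := pi_div_two_le_of_bounds hx.le (by linarith) hT0 h.map_one hsum
    (M := M) (fun t ht => le_ciSup hbdd ⟨t, ht⟩) hB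
  have htail : 8 * B / T ^ 2 ≤ 1 / 2 := by
    rw [div_le_iff₀ (by positivity)]
    linarith
  have hpi := Real.pi_gt_three
  by_contra! hlt
  nlinarith
end
end

section
/- Repulsion of large values of F (Proposition 5.1): For every κ > 0 and every natural number ℓ ≥ 1 there is a constant C = C(ℓ,κ) > 0 such that the following holds for all f in the class C(κ) and all real x ≥ C. Let 0 ≤ ρ ≤ 1, let t₁, …, t_ℓ be real numbers with |t_j| ≤ (log x)^κ for all j and |t_j − t_k| ≥ (log x)^{−ρ} for all j ≠ k, and let δ₁, …, δ_ℓ ≥ 0 be real numbers. Then ∑_{j=1}^{ℓ} log |F(1 + 1/log x + δ_j + i·t_j)| ≤ κ·( ℓ + ℓ(ℓ−1)·ρ )^{1/2}·log log x + C·log log log x. -/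
open Complex MeasureTheory
open scoped Classical

noncomputable section

namespace IsHalaszClass

variable {κ : ℝ} {f Λf : ℕ → ℂ}

lemma abscissa_le_one (h : IsHalaszClass κ f Λf) : LSeries.abscissaOfAbsConv f ≤ 1 := by
  refine LSeries.abscissaOfAbsConv_le_of_forall_lt_LSeriesSummable (x := 1) fun y hy ↦ ?_
  rw [LSeriesSummable, ← summable_norm_iff]
  refine (h.abs_conv y hy).of_nonneg_of_le (fun _ ↦ norm_nonneg _) fun n ↦ ?_
  rw [LSeries.norm_term_eq]
  split_ifs
  · positivity
  · simp

lemma norm_log_coeff_le (h : IsHalaszClass κ f Λf) (n : ℕ) :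
    ‖Λf n / (Real.log n : ℂ)‖ ≤ κ * (ArithmeticFunction.vonMangoldt n / Real.log n) := by
  rcases Nat.eq_zero_or_pos n with rfl | hn
  · simp
  have hlog : 0 ≤ Real.log n := Real.log_natCast_nonneg n
  rw [norm_div, Complex.norm_real, Real.norm_of_nonneg hlog, ← mul_div_assoc]
  exact div_le_div_of_nonneg_right (h.bound n hn) hlog

lemma log_mul_log_coeff (h : IsHalaszClass κ f Λf) {n : ℕ} (hn : n ≠ 0) :
    (Real.log n : ℂ) * (Λf n / (Real.log n : ℂ)) = Λf n := by
  rcases eq_or_ne n 1 with rfl | h1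
  · simp [h.supp 1 not_isPrimePow_one]
  · have : (Real.log n : ℂ) ≠ 0 := by
      exact_mod_cast (Real.log_pos (by exact_mod_cast (by omega : 1 < n))).ne'
    field_simp

lemma abscissa_log_coeff_le_one (h : IsHalaszClass κ f Λf) :
    LSeries.abscissaOfAbsConv (fun n ↦ Λf n / (Real.log n : ℂ)) ≤ 1 := by
  rw [← LSeries.abscissaOfAbsConv_logMul]
  refine LSeries.abscissaOfAbsConv_le_of_forall_lt_LSeriesSummable (x := 1) fun y hy ↦ ?_
  have hΛ := ArithmeticFunction.LSeriesSummable_vonMangoldt (s := y) (by simpa using hy)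
  rw [LSeriesSummable, ← summable_norm_iff] at hΛ ⊢
  refine (hΛ.mul_left κ).of_nonneg_of_le (fun _ ↦ norm_nonneg _) fun n ↦ ?_
  rw [LSeries.norm_term_eq, LSeries.norm_term_eq]
  split_ifs with hn
  · simp
  · rw [LSeries.logMul, ← Complex.ofReal_natCast, ← Complex.ofReal_log (Nat.cast_nonneg n),
      h.log_mul_log_coeff hn, Complex.norm_real,
      Real.norm_of_nonneg ArithmeticFunction.vonMangoldt_nonneg, ← mul_div_assoc]
    gcongr
    exact h.bound n (Nat.pos_of_ne_zero hn)

lemma logMul_eq_convolution (h : IsHalaszClass κ f Λf) {n : ℕ} (hn : n ≠ 0) :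
    LSeries.logMul f n =
      LSeries.convolution (LSeries.logMul fun n ↦ Λf n / (Real.log n : ℂ)) f n := by
  rw [LSeries.convolution_def]
  simp only [LSeries.logMul]
  rw [Nat.sum_divisorsAntidiagonal
    (fun a b ↦ Complex.log a * (Λf a / (Real.log a : ℂ)) * f b), ← Complex.ofReal_natCast,
    ← Complex.ofReal_log (Nat.cast_nonneg n), mul_comm, h.conv n (Nat.pos_of_ne_zero hn)]
  refine Finset.sum_congr rfl fun d hd ↦ ?_
  rw [← Complex.ofReal_natCast, ← Complex.ofReal_log (Nat.cast_nonneg d),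
    h.log_mul_log_coeff (Nat.pos_of_mem_divisors hd).ne']

/-- On `1 < re s`, the Dirichlet series of `f` is the exponential of `∑ Λf(n) / log n * n^{-s}`. -/
lemma LSeries_eq_exp (h : IsHalaszClass κ f Λf) {s : ℂ} (hs : 1 < s.re) :
    LSeries f s = Complex.exp (LSeries (fun n ↦ Λf n / (Real.log n : ℂ)) s) := by
  set g : ℕ → ℂ := fun n ↦ Λf n / (Real.log n : ℂ) with hg
  have hf {z : ℂ} (hz : 1 < z.re) : LSeries.abscissaOfAbsConv f < z.re :=
    h.abscissa_le_one.trans_lt (by exact_mod_cast hz)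
  have hg' {z : ℂ} (hz : 1 < z.re) : LSeries.abscissaOfAbsConv g < z.re :=
    h.abscissa_log_coeff_le_one.trans_lt (by exact_mod_cast hz)
  let U : Set ℂ := {z | 1 < z.re}
  have hU : IsOpen U := isOpen_lt continuous_const Complex.continuous_re
  have hUc : IsPreconnected U := (convex_halfSpace_re_gt 1).isPreconnected
  have hderiv {z : ℂ} (hz : 1 < z.re) :
      HasDerivAt (fun z ↦ LSeries f z * Complex.exp (-LSeries g z)) 0 z := by
    have h1 := (LSeries_hasDerivAt (hf hz)).mul (LSeries_hasDerivAt (hg' hz)).neg.cexp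
    refine h1.congr_deriv ?_
    rw [LSeries_congr (fun hn ↦ h.logMul_eq_convolution hn) z,
      LSeries_convolution (by rw [LSeries.abscissaOfAbsConv_logMul]; exact hg' hz) (hf hz)]
    ring
  obtain ⟨a, ha⟩ := hU.exists_is_const_of_deriv_eq_zero hUc
    (fun z hz ↦ (hderiv hz).differentiableAt.differentiableWithinAt)
    (fun z hz ↦ (hderiv hz).deriv)
  have hlim : Filter.Tendsto (fun y : ℝ ↦ LSeries f y * Complex.exp (-LSeries g y))
      Filter.atTop (nhds (f 1 * Complex.exp (-g 1))) :=
    (LSeries.tendsto_atTop (h.abscissa_le_one.trans_lt (by exact EReal.coe_lt_top 1))).mul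
      ((Complex.continuous_exp.tendsto _).comp
        (LSeries.tendsto_atTop
          (h.abscissa_log_coeff_le_one.trans_lt (by exact EReal.coe_lt_top 1))).neg)
  have ha1 : a = 1 := by
    refine tendsto_nhds_unique (tendsto_const_nhds.congr' ?_) (hlim.trans_eq ?_)
    · filter_upwards [Filter.eventually_gt_atTop 1] with y hy
      exact (ha y (by simpa [U] using hy)).symm
    · simp [hg, h.map_one]
  have := ha s hs
  rw [ha1, Complex.exp_neg] at this
  exact (mul_inv_eq_one₀ (Complex.exp_ne_zero _)).mp this

lemma hasSum_re_term (h : IsHalaszClass κ f Λf) {s : ℂ} (hs : 1 < s.re) :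
    HasSum (fun n ↦ (LSeries.term (fun n ↦ Λf n / (Real.log n : ℂ)) s n).re)
      (Real.log ‖LSeries f s‖) := by
  rw [h.LSeries_eq_exp hs, Complex.norm_exp, Real.log_exp]
  refine Complex.hasSum_re (LSeriesSummable_of_abscissaOfAbsConv_lt_re ?_).hasSum
  exact h.abscissa_log_coeff_le_one.trans_lt (by exact_mod_cast hs)

end IsHalaszClass

lemma Fser_eq_LSeries (f : ℕ → ℂ) {s : ℂ} (hs : s ≠ 0) : Fser f s = LSeries f s := by
  refine tsum_congr fun n ↦ ?_
  rcases eq_or_ne n 0 with rfl | hn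
  · simp [Complex.zero_cpow hs]
  · rw [LSeries.term_of_ne_zero hn]

lemma isHalaszClass_one :
    IsHalaszClass 1 1 (fun n ↦ (ArithmeticFunction.vonMangoldt n : ℂ)) where
  map_one := rfl
  mult _ _ _ := by simp
  supp n hn := by simpa using ArithmeticFunction.vonMangoldt_eq_zero_iff.mpr hn
  bound n _ := by
    rw [Complex.norm_real, Real.norm_of_nonneg ArithmeticFunction.vonMangoldt_nonneg, one_mul]
  conv n _ := by
    rw [← ArithmeticFunction.vonMangoldt_sum]
    simp
  abs_conv σ hσ := by simpa using Real.summable_nat_rpow_inv.mpr hσ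

lemma hasSum_re_term_log_zeta {s : ℂ} (hs : 1 < s.re) :
    HasSum (fun n ↦ (LSeries.term
      (fun n ↦ (ArithmeticFunction.vonMangoldt n : ℂ) / (Real.log n : ℂ)) s n).re)
      (Real.log ‖riemannZeta s‖) := by
  rw [← LSeries_one_eq_riemannZeta hs]
  exact isHalaszClass_one.hasSum_re_term hs

lemma norm_natCast_cpow_neg_sub_telescope_le {s : ℂ} (hs : 1 < s.re) {n : ℕ} (hn : 1 ≤ n) :
    ‖(n : ℂ) ^ (-s) - ((n : ℂ) ^ (1 - s) - ((n + 1 : ℕ) : ℂ) ^ (1 - s)) / (s - 1)‖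
      ≤ ‖s‖ / (n : ℝ) ^ 2 := by
  have hn0 : (1 : ℝ) ≤ n := by exact_mod_cast hn
  have hs1 : s - 1 ≠ 0 := by
    intro h0
    have := congrArg Complex.re h0
    simp at this
    linarith
  let I : Set ℝ := Set.Icc (n : ℝ) (n + 1)
  have hpos {u : ℝ} (hu : u ∈ I) : 0 < u := by linarith [hu.1]
  have hd1 (u : ℝ) (hu : u ∈ I) :
      HasDerivWithinAt (fun u : ℝ ↦ (u : ℂ) ^ (-s)) (-s * (u : ℂ) ^ (-s - 1)) I u := by
    refine HasDerivAt.hasDerivWithinAt ?_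
    have := (hasDerivAt_id (u : ℂ)).cpow_const (c := -s)
      (Or.inl (by simpa using hpos hu))
    simpa using this.comp_ofReal
  have hb1 (u : ℝ) (hu : u ∈ I) : ‖-s * (u : ℂ) ^ (-s - 1)‖ ≤ ‖s‖ / (n : ℝ) ^ 2 := by
    rw [norm_mul, norm_neg, Complex.norm_cpow_eq_rpow_re_of_pos (hpos hu), div_eq_mul_inv]
    gcongr
    calc u ^ (-s - 1).re ≤ u ^ (-2 : ℝ) := by
          refine Real.rpow_le_rpow_of_exponent_le (hn0.trans hu.1) ?_
          simp
          linarith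
      _ = (u ^ 2)⁻¹ := by rw [Real.rpow_neg (hpos hu).le]; norm_cast
      _ ≤ ((n : ℝ) ^ 2)⁻¹ := by
          have := hu.1
          gcongr
  have hmem : (n : ℝ) ∈ I := ⟨le_rfl, by linarith⟩
  have hmem' : (n + 1 : ℝ) ∈ I := ⟨by linarith, le_rfl⟩
  have hd2 (u : ℝ) (hu : u ∈ I) :
      HasDerivWithinAt (fun u : ℝ ↦ (u : ℂ) ^ (1 - s) / (s - 1) + (u : ℂ) * (n : ℂ) ^ (-s))
        ((n : ℂ) ^ (-s) - (u : ℂ) ^ (-s)) I u := by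
    refine HasDerivAt.hasDerivWithinAt ?_
    have h1 := ((hasDerivAt_id (u : ℂ)).cpow_const (c := 1 - s)
      (Or.inl (by simpa using hpos hu))).comp_ofReal.div_const (s - 1)
    have h2 := (hasDerivAt_id (u : ℂ)).comp_ofReal.mul_const ((n : ℂ) ^ (-s))
    refine (h1.add h2).congr_deriv ?_
    have : (1 - s - 1 : ℂ) = -s := by ring
    simp only [id, this]
    field_simp
    ring
  have hb2 (u : ℝ) (hu : u ∈ I) : ‖(n : ℂ) ^ (-s) - (u : ℂ) ^ (-s)‖ ≤ ‖s‖ / (n : ℝ) ^ 2 := by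
    have := (convex_Icc (n : ℝ) (n + 1)).norm_image_sub_le_of_norm_hasDerivWithin_le hd1 hb1
      hu hmem
    simp only [Complex.ofReal_natCast] at this
    refine this.trans (mul_le_of_le_one_right (by positivity) ?_)
    rw [Real.norm_eq_abs, abs_le]
    constructor <;> linarith [hu.1, hu.2]
  have := (convex_Icc (n : ℝ) (n + 1)).norm_image_sub_le_of_norm_hasDerivWithin_le hd2 hb2
    hmem hmem'
  simp only [add_sub_cancel_left, norm_one, mul_one] at this
  refine le_of_eq_of_le (congrArg _ ?_) this
  push_cast
  field_simp
  ring

lemma norm_sum_range_cpow_sub_le {s : ℂ} (hs : 1 < s.re) {N K : ℕ} (hN : 1 ≤ N) (hK : N ≤ K) :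
    ‖∑ i ∈ Finset.range K, ((i + 1 : ℕ) : ℂ) ^ (-s)
        - ∑ i ∈ Finset.range N, ((i + 1 : ℕ) : ℂ) ^ (-s)
        - (((N + 1 : ℕ) : ℂ) ^ (1 - s) - ((K + 1 : ℕ) : ℂ) ^ (1 - s)) / (s - 1)‖
      ≤ ‖s‖ * (1 / N - 1 / K) := by
  induction K, hK using Nat.le_induction with
  | base => simp
  | succ K hK ih =>
    have hK0 : (0 : ℝ) < K := by exact_mod_cast (by omega : 0 < K)
    have h1 := norm_natCast_cpow_neg_sub_telescope_le hs (n := K + 1) (by omega)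
    have h2 : ‖s‖ / ((K + 1 : ℕ) : ℝ) ^ 2 ≤ ‖s‖ * (1 / K - 1 / (K + 1 : ℕ)) := by
      rw [div_eq_mul_inv]
      gcongr
      push_cast
      rw [div_sub_div _ _ hK0.ne' (by positivity), inv_eq_one_div,
        div_le_div_iff₀ (by positivity) (by positivity)]
      nlinarith
    refine le_trans (le_of_eq_of_le (congrArg _ ?_) (norm_add_le _ _))
      ((add_le_add ih (h1.trans h2)).trans_eq (by ring))
    rw [Finset.sum_range_succ]
    ring

lemma norm_riemannZeta_le_log_norm {s : ℂ} (hs : 1 < s.re) :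
    ‖riemannZeta s‖ ≤ 2 + Real.log (‖s‖ + 1) + 2 / ‖s - 1‖ := by
  have hs' : 1 < ‖s‖ := hs.trans_le (Complex.re_le_norm s)
  set N : ℕ := ⌈‖s‖⌉₊ with hNdef
  have hN : 1 ≤ N := Nat.one_le_ceil_iff.mpr (by linarith)
  have hNs : ‖s‖ ≤ N := Nat.le_ceil _
  have hNs' : (N : ℝ) ≤ ‖s‖ + 1 := (Nat.ceil_lt_add_one (norm_nonneg _)).le
  have hN0 : (0 : ℝ) < N := by exact_mod_cast hN
  have hsum : HasSum (fun i : ℕ ↦ ((i + 1 : ℕ) : ℂ) ^ (-s)) (riemannZeta s) := by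
    have h0 := (summable_nat_add_iff 1).mpr (Complex.summable_one_div_nat_cpow.mpr hs)
    have h1 := zeta_eq_tsum_one_div_nat_add_one_cpow hs
    simp only [one_div, ← Complex.cpow_neg] at h0 h1
    rw [h1]
    exact_mod_cast h0.hasSum
  refine le_of_tendsto hsum.tendsto_sum_nat.norm ?_
  filter_upwards [Filter.eventually_ge_atTop N] with K hK
  have hpow (m : ℕ) : ‖((m + 1 : ℕ) : ℂ) ^ (1 - s)‖ ≤ 1 := by
    rw [Complex.norm_natCast_cpow_of_pos (by omega)]
    refine Real.rpow_le_one_of_one_le_of_nonpos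
      (by push_cast; linarith [m.cast_nonneg (α := ℝ)]) ?_
    simp
    linarith
  have hmain := norm_sum_range_cpow_sub_le hs hN hK
  have hhead : ‖∑ i ∈ Finset.range N, ((i + 1 : ℕ) : ℂ) ^ (-s)‖ ≤ 1 + Real.log (‖s‖ + 1) := by
    calc _ ≤ ∑ i ∈ Finset.range N, ((i + 1 : ℕ) : ℝ)⁻¹ := by
          refine norm_sum_le_of_le _ fun i _ ↦ ?_
          rw [Complex.norm_natCast_cpow_of_pos (by omega), ← Real.rpow_neg_one]
          refine Real.rpow_le_rpow_of_exponent_le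
            (by push_cast; linarith [i.cast_nonneg (α := ℝ)]) ?_
          simp
          linarith
      _ = (harmonic N : ℝ) := by simp [harmonic]
      _ ≤ 1 + Real.log N := harmonic_le_one_add_log N
      _ ≤ _ := by gcongr
  have hmid : ‖(((N + 1 : ℕ) : ℂ) ^ (1 - s) - ((K + 1 : ℕ) : ℂ) ^ (1 - s)) / (s - 1)‖
      ≤ 2 / ‖s - 1‖ := by
    rw [norm_div]
    gcongr
    exact (norm_sub_le _ _).trans (by linarith [hpow N, hpow K])
  have htail : ‖s‖ * (1 / N - 1 / K) ≤ 1 := by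
    calc ‖s‖ * (1 / N - 1 / K) ≤ N * (1 / N - 0) := by
          have : (1 : ℝ) / K ≤ 1 / N := by gcongr
          gcongr
          positivity
      _ = 1 := by field_simp; simp
  set S := ∑ i ∈ Finset.range K, ((i + 1 : ℕ) : ℂ) ^ (-s)
  set H := ∑ i ∈ Finset.range N, ((i + 1 : ℕ) : ℂ) ^ (-s)
  set T := (((N + 1 : ℕ) : ℂ) ^ (1 - s) - ((K + 1 : ℕ) : ℂ) ^ (1 - s)) / (s - 1)
  calc ‖S‖ = ‖(S - H - T) + H + T‖ := by congr 1; ring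
    _ ≤ ‖S - H - T‖ + ‖H‖ + ‖T‖ := norm_add₃_le
    _ ≤ _ := by linarith

lemma norm_riemannZeta_le_two {s : ℂ} (hs : 2 ≤ s.re) : ‖riemannZeta s‖ ≤ 2 := by
  rw [zeta_eq_tsum_one_div_nat_cpow (by linarith)]
  refine (tsum_of_norm_bounded hasSum_zeta_two fun n ↦ ?_).trans ?_
  · rcases Nat.eq_zero_or_pos n with rfl | hn
    · have : s ≠ 0 := by rintro rfl; simp at hs; linarith
      simp [Complex.zero_cpow this]
    · rw [norm_div, norm_one, Complex.norm_natCast_cpow_of_pos hn, ← Real.rpow_natCast]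
      gcongr
      · exact_mod_cast hn
      · simpa using hs
  · nlinarith [Real.pi_lt_d2, Real.pi_pos]

/-- Bound for `ζ` to the right of the line `re s = 1`, uniform up to the pole. -/
lemma norm_riemannZeta_le {s : ℂ} (hs : 1 < s.re) :
    ‖riemannZeta s‖ ≤ 2 + Real.log (3 + |s.im|) + 2 / ‖s - 1‖ := by
  rcases le_total s.re 2 with h2 | h2
  · refine (norm_riemannZeta_le_log_norm hs).trans ?_
    have : ‖s‖ ≤ |s.re| + |s.im| := Complex.norm_le_abs_re_add_abs_im s
    rw [abs_of_pos (by linarith)] at this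
    gcongr 2 + Real.log ?_ + _
    linarith
  · have : 0 ≤ Real.log (3 + |s.im|) := Real.log_nonneg (by linarith [abs_nonneg s.im])
    have : 0 ≤ 2 / ‖s - 1‖ := by positivity
    linarith [norm_riemannZeta_le_two h2]

/-- Duality inequality comparing values of `F` with values of `ζ` at differences of the points. -/
lemma sum_log_norm_Fser_le {κ : ℝ} {f Λf : ℕ → ℂ} (hκ : 0 ≤ κ) (h : IsHalaszClass κ f Λf)
    {ι : Type*} [Fintype ι] {σ : ℝ} (hσ : 1 < σ) (u : ι → ℂ) (hu : ∀ j, 0 ≤ (u j).re)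
    {c : ℝ} (hc : 0 < c) :
    ∑ j, Real.log ‖Fser f (σ + u j)‖ ≤ κ / 2 * (c * Real.log ‖riemannZeta σ‖ +
      c⁻¹ * ∑ j, ∑ k, Real.log ‖riemannZeta (σ + u j + (starRingEnd ℂ) (u k))‖) := by
  have hre (j : ι) : 1 < ((σ : ℂ) + u j).re := by simpa using by linarith [hu j]
  have hre2 (j k : ι) : 1 < ((σ : ℂ) + u j + (starRingEnd ℂ) (u k)).re := by
    simpa using by linarith [hu j, hu k]
  have hF (j : ι) : Fser f (σ + u j) = LSeries f (σ + u j) := by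
    refine Fser_eq_LSeries f fun h0 ↦ ?_
    have := hre j
    rw [h0] at this
    simp at this
    linarith
  simp only [hF]
  refine hasSum_le (fun n ↦ ?_) (hasSum_sum fun j _ ↦ h.hasSum_re_term (hre j))
    ((((hasSum_re_term_log_zeta (s := σ) (by simpa using hσ)).mul_left c).add
      ((hasSum_sum fun j _ ↦ hasSum_sum fun k _ ↦
        hasSum_re_term_log_zeta (hre2 j k)).mul_left c⁻¹)).mul_left (κ / 2))
  rcases eq_or_ne n 0 with rfl | hn
  · simp
  have hn0 : (n : ℂ) ≠ 0 := by exact_mod_cast hn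
  have hnpos : 0 < n := Nat.pos_of_ne_zero hn
  simp only [LSeries.term_of_ne_zero hn]
  set w : ℝ := ArithmeticFunction.vonMangoldt n / Real.log n with hw
  set v : ℝ := ((n : ℝ) ^ σ)⁻¹ with hv
  have hw0 : 0 ≤ w := div_nonneg ArithmeticFunction.vonMangoldt_nonneg (Real.log_natCast_nonneg n)
  have hv0 : 0 ≤ v := by positivity
  have hvc : ((n : ℂ) ^ (σ : ℂ))⁻¹ = (v : ℂ) := by
    rw [hv, Complex.ofReal_inv, Complex.ofReal_cpow (Nat.cast_nonneg n)]
    simp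
  set A : ℂ := ∑ j, (n : ℂ) ^ (-u j) with hA
  have hlhs : ∑ j, (Λf n / (Real.log n : ℂ) / (n : ℂ) ^ ((σ : ℂ) + u j)).re
      = (Λf n / (Real.log n : ℂ) * v * A).re := by
    rw [hA, Finset.mul_sum, Complex.re_sum]
    refine Finset.sum_congr rfl fun j _ ↦ ?_
    rw [Complex.cpow_add _ _ hn0, Complex.cpow_neg, ← hvc, div_eq_mul_inv, mul_inv, mul_assoc]
  have hmid : ((ArithmeticFunction.vonMangoldt n : ℂ) / (Real.log n : ℂ)
      / (n : ℂ) ^ (σ : ℂ)).re = w * v := by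
    rw [div_eq_mul_inv _ ((n : ℂ) ^ (σ : ℂ)), hvc, ← Complex.ofReal_div, ← hw,
      ← Complex.ofReal_mul, Complex.ofReal_re]
  have hrhs : ∑ j, ∑ k, ((ArithmeticFunction.vonMangoldt n : ℂ) / (Real.log n : ℂ)
      / (n : ℂ) ^ ((σ : ℂ) + u j + (starRingEnd ℂ) (u k))).re = w * v * ‖A‖ ^ 2 := by
    have : ((w * v * ‖A‖ ^ 2 : ℝ) : ℂ) = w * v * (A * (starRingEnd ℂ) A) := by
      rw [Complex.mul_conj, Complex.normSq_eq_norm_sq]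
      push_cast
      ring
    rw [← Complex.ofReal_re (w * v * ‖A‖ ^ 2), this, hA, map_sum, Finset.sum_mul_sum,
      Finset.mul_sum, Complex.re_sum]
    refine Finset.sum_congr rfl fun j _ ↦ ?_
    rw [Finset.mul_sum, Complex.re_sum]
    refine Finset.sum_congr rfl fun k _ ↦ ?_
    have hconj : (starRingEnd ℂ) ((n : ℂ) ^ (-u k)) = (n : ℂ) ^ (-(starRingEnd ℂ) (u k)) := by
      rw [← map_neg, Complex.cpow_conj _ _ (by rw [Complex.natCast_arg]; exact Real.pi_pos.ne),
        Complex.conj_natCast]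
    rw [hconj, Complex.cpow_add _ _ hn0, Complex.cpow_add _ _ hn0, Complex.cpow_neg,
      Complex.cpow_neg, ← hvc, hw, Complex.ofReal_div, div_eq_mul_inv, mul_inv, mul_inv,
      mul_assoc, mul_assoc]
  rw [hlhs, hmid, hrhs]
  have hcoeff : ‖Λf n / (Real.log n : ℂ)‖ ≤ κ * w := h.norm_log_coeff_le n
  calc (Λf n / (Real.log n : ℂ) * v * A).re ≤ ‖Λf n / (Real.log n : ℂ) * v * A‖ :=
        Complex.re_le_norm _
    _ = ‖Λf n / (Real.log n : ℂ)‖ * v * ‖A‖ := by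
        rw [norm_mul, norm_mul, Complex.norm_real, Real.norm_of_nonneg hv0]
    _ ≤ κ * w * v * ‖A‖ := by gcongr
    _ = κ * (w * v) * ‖A‖ := by ring
    _ ≤ κ * (w * v) * ((c + c⁻¹ * ‖A‖ ^ 2) / 2) := by
        gcongr
        have : (c + c⁻¹ * ‖A‖ ^ 2) / 2 - ‖A‖ = c⁻¹ / 2 * (c - ‖A‖) ^ 2 := by
          field_simp
          ring
        have : 0 ≤ c⁻¹ / 2 * (c - ‖A‖) ^ 2 := by positivity
        linarith
    _ = _ := by ring

lemma log_norm_riemannZeta_le_of_near {L : ℝ} (hL : 1 ≤ L) {s : ℂ} (hs : 1 + 1 / L ≤ s.re)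
    (him : s.im = 0) : Real.log ‖riemannZeta s‖ ≤ Real.log L + 6 := by
  have hL0 : 0 < L := by linarith
  have hs1 : 1 < s.re := by linarith [one_div_pos.mpr hL0]
  have hpos : 0 < ‖riemannZeta s‖ := norm_pos_iff.mpr (riemannZeta_ne_zero_of_one_lt_re hs1)
  have hdist : 1 / L ≤ ‖s - 1‖ := by
    refine le_trans ?_ (Complex.re_le_norm _)
    simp only [Complex.sub_re, Complex.one_re]
    linarith
  have hinv : 2 / ‖s - 1‖ ≤ 2 * L := by
    rw [div_le_iff₀ ((one_div_pos.mpr hL0).trans_le hdist)]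
    calc (2 : ℝ) = 2 * L * (1 / L) := by field_simp
      _ ≤ _ := by gcongr
  have h3 : Real.log (3 + |s.im|) ≤ 2 := by
    rw [him, abs_zero, add_zero]
    linarith [Real.log_le_sub_one_of_pos (by norm_num : (0 : ℝ) < 3)]
  have hb : ‖riemannZeta s‖ ≤ 6 * L := by linarith [norm_riemannZeta_le hs1]
  calc Real.log ‖riemannZeta s‖ ≤ Real.log (6 * L) := Real.log_le_log hpos hb
    _ = Real.log 6 + Real.log L := Real.log_mul (by norm_num) hL0.ne'
    _ ≤ _ := by linarith [Real.log_le_sub_one_of_pos (by norm_num : (0 : ℝ) < 6)]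

lemma log_norm_riemannZeta_le_of_far {κ L ρ : ℝ} (hκ : 0 < κ) (hL : 1 ≤ Real.log L)
    (hL1 : 1 ≤ L) (hρ : 0 ≤ ρ) {s : ℂ} (hs : 1 < s.re) (hlow : L ^ (-ρ) ≤ |s.im|)
    (hup : |s.im| ≤ 2 * L ^ κ) :
    Real.log ‖riemannZeta s‖ ≤
      ρ * Real.log L + (7 + κ) + Real.log (Real.log L) := by
  have hL0 : 0 < L := by linarith
  have hpos : 0 < ‖riemannZeta s‖ := norm_pos_iff.mpr (riemannZeta_ne_zero_of_one_lt_re hs)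
  have hdist : L ^ (-ρ) ≤ ‖s - 1‖ := by
    refine hlow.trans ?_
    simpa using Complex.abs_im_le_norm (s - 1)
  have hρ1 : 1 ≤ L ^ ρ := Real.one_le_rpow hL1 hρ
  have hκ1 : 1 ≤ L ^ κ := Real.one_le_rpow hL1 hκ.le
  have hinv : 2 / ‖s - 1‖ ≤ 2 * L ^ ρ := by
    rw [div_le_iff₀ ((by positivity : 0 < L ^ (-ρ)).trans_le hdist)]
    calc (2 : ℝ) = 2 * L ^ ρ * L ^ (-ρ) := by
          rw [mul_assoc, ← Real.rpow_add hL0]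
          simp
      _ ≤ _ := by gcongr
  have h3 : Real.log (3 + |s.im|) ≤ 4 + κ * Real.log L := by
    calc Real.log (3 + |s.im|) ≤ Real.log (5 * L ^ κ) := by
          refine Real.log_le_log (by positivity) (by linarith)
      _ = Real.log 5 + κ * Real.log L := by
          rw [Real.log_mul (by norm_num) (by positivity), Real.log_rpow hL0]
      _ ≤ _ := by linarith [Real.log_le_sub_one_of_pos (by norm_num : (0 : ℝ) < 5)]
  have hb : ‖riemannZeta s‖ ≤ (8 + κ) * Real.log L * L ^ ρ := by
    have hz := norm_riemannZeta_le hs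
    have h1 : 0 ≤ (Real.log L - 1) * (L ^ ρ) := mul_nonneg (by linarith) (by linarith)
    have h2 : 0 ≤ κ * Real.log L * (L ^ ρ - 1) :=
      mul_nonneg (by positivity) (by linarith)
    nlinarith
  calc Real.log ‖riemannZeta s‖ ≤ Real.log ((8 + κ) * Real.log L * L ^ ρ) :=
        Real.log_le_log hpos hb
    _ = Real.log (8 + κ) + Real.log (Real.log L) + ρ * Real.log L := by
        rw [Real.log_mul (by positivity) (by positivity),
          Real.log_mul (by positivity) (by positivity), Real.log_rpow hL0]
    _ ≤ _ := by linarith [Real.log_le_sub_one_of_pos (by positivity : 0 < 8 + κ)]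

theorem repulsion_large_values (κ : ℝ) (hκ : 0 < κ) (ℓ : ℕ) (hℓ : 1 ≤ ℓ) :
    ∃ C : ℝ, 0 < C ∧ ∀ f Λf : ℕ → ℂ, IsHalaszClass κ f Λf → ∀ x : ℝ, C ≤ x →
    ∀ ρ : ℝ, 0 ≤ ρ → ρ ≤ 1 → ∀ t δ : Fin ℓ → ℝ,
      (∀ j, |t j| ≤ Real.log x ^ κ) →
      (∀ j k, j ≠ k → Real.log x ^ (-ρ) ≤ |t j - t k|) →
      (∀ j, 0 ≤ δ j) →
      (∑ j, Real.log
          ‖Fser f (((1 + 1 / Real.log x + δ j : ℝ) : ℂ) + (t j : ℂ) * Complex.I)‖) ≤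
        κ * Real.sqrt ((ℓ : ℝ) + (ℓ : ℝ) * ((ℓ : ℝ) - 1) * ρ) * Real.log (Real.log x)
          + C * Real.log (Real.log (Real.log x)) := by
  have hℓ1 : (1 : ℝ) ≤ ℓ := by exact_mod_cast hℓ
  refine ⟨Real.exp (Real.exp (Real.exp 1)) + κ * (ℓ : ℝ) ^ 2 * (8 + κ), by positivity, ?_⟩
  intro f Λf hf x hx ρ hρ0 hρ1 t δ ht hsep hδ
  set B : ℝ := 8 + κ with hB
  have hB0 : 0 < B := by positivity
  have hx' : Real.exp (Real.exp (Real.exp 1)) ≤ x := by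
    have : 0 ≤ κ * (ℓ : ℝ) ^ 2 * B := by positivity
    linarith
  set L : ℝ := Real.log x with hLdef
  have hL : Real.exp (Real.exp 1) ≤ L :=
    (Real.le_log_iff_exp_le ((Real.exp_pos _).trans_le hx')).mpr hx'
  have hL0 : 0 < L := (Real.exp_pos _).trans_le hL
  set M₂ : ℝ := Real.log L with hM₂
  have hLL : Real.exp 1 ≤ M₂ := (Real.le_log_iff_exp_le hL0).mpr hL
  have hLL0 : 0 < M₂ := (Real.exp_pos _).trans_le hLL
  set M₃ : ℝ := Real.log M₂ with hM₃
  have hLLL : 1 ≤ M₃ := (Real.le_log_iff_exp_le hLL0).mpr hLL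
  have hLL1 : 1 ≤ M₂ := by linarith [Real.add_one_le_exp 1]
  have hL1 : 1 ≤ L := by linarith [Real.add_one_le_exp (Real.exp 1), Real.exp_pos 1]
  set M : ℝ := (ℓ : ℝ) + (ℓ : ℝ) * ((ℓ : ℝ) - 1) * ρ with hM
  have hprod : 0 ≤ (ℓ : ℝ) * ((ℓ : ℝ) - 1) := mul_nonneg (by linarith) (by linarith)
  have hM1 : 1 ≤ M := by linarith [mul_nonneg hprod hρ0]
  have hMℓ : M ≤ (ℓ : ℝ) ^ 2 := by
    nlinarith [mul_nonneg hprod (by linarith : 0 ≤ 1 - ρ)]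
  have hc1 : 1 ≤ √M := Real.one_le_sqrt.mpr hM1
  have hcℓ : √M ≤ ℓ := Real.sqrt_le_iff.mpr ⟨by linarith, hMℓ⟩
  have hσ : 1 < 1 + 1 / L := by linarith [one_div_pos.mpr hL0]
  have key := sum_log_norm_Fser_le hκ.le hf hσ (fun j ↦ (δ j : ℂ) + (t j : ℂ) * Complex.I)
    (fun j ↦ by simpa using hδ j) (c := √M) (by linarith)
  have harg (j : Fin ℓ) : ((1 + 1 / L + δ j : ℝ) : ℂ) + (t j : ℂ) * Complex.I
      = ((1 + 1 / L : ℝ) : ℂ) + ((δ j : ℂ) + (t j : ℂ) * Complex.I) := by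
    push_cast
    ring
  simp only [harg]
  refine key.trans ?_
  have hdiag : Real.log ‖riemannZeta ((1 + 1 / L : ℝ) : ℂ)‖ ≤ M₂ + B * M₃ := by
    have := log_norm_riemannZeta_le_of_near hL1 (s := ((1 + 1 / L : ℝ) : ℂ))
      (by rw [Complex.ofReal_re]) (Complex.ofReal_im _)
    nlinarith
  have hpair (j k : Fin ℓ) : Real.log ‖riemannZeta (((1 + 1 / L : ℝ) : ℂ)
        + ((δ j : ℂ) + (t j : ℂ) * Complex.I)
        + (starRingEnd ℂ) ((δ k : ℂ) + (t k : ℂ) * Complex.I))‖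
      ≤ ((if j = k then 1 - ρ else 0) + ρ) * M₂ + B * M₃ := by
    set s : ℂ := ((1 + 1 / L : ℝ) : ℂ) + ((δ j : ℂ) + (t j : ℂ) * Complex.I)
        + (starRingEnd ℂ) ((δ k : ℂ) + (t k : ℂ) * Complex.I) with hs
    have hsre : s.re = 1 + 1 / L + δ j + δ k := by
      simp only [hs, Complex.add_re, Complex.ofReal_re, Complex.conj_re, Complex.re_ofReal_mul,
        Complex.I_re]
      ring
    have hsim : s.im = t j - t k := by
      simp only [hs, Complex.add_im, Complex.ofReal_im, Complex.conj_im, Complex.im_ofReal_mul,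
        Complex.I_im]
      ring
    split_ifs with hjk
    · have := log_norm_riemannZeta_le_of_near hL1 (s := s) (by linarith [hδ j, hδ k])
        (by rw [hsim, hjk, sub_self])
      nlinarith
    · have hup : |s.im| ≤ 2 * L ^ κ := by
        rw [hsim]
        linarith [abs_sub (t j) (t k), ht j, ht k]
      have := log_norm_riemannZeta_le_of_far hκ hLL1 hL1 hρ0 (s := s)
        (by linarith [hδ j, hδ k]) (by rw [hsim]; exact hsep j k hjk) hup
      nlinarith
  have hsum := Finset.sum_le_sum fun j (_ : j ∈ Finset.univ) ↦
    Finset.sum_le_sum fun k (_ : k ∈ Finset.univ) ↦ hpair j k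
  have hcount : ∑ j : Fin ℓ, ∑ k : Fin ℓ, (((if j = k then 1 - ρ else 0) + ρ) * M₂ + B * M₃)
      = M * M₂ + (ℓ : ℝ) ^ 2 * (B * M₃) := by
    simp only [Finset.sum_add_distrib, ← Finset.sum_mul, Finset.sum_ite_eq, Finset.mem_univ,
      if_true, Finset.sum_const, Finset.card_univ, Fintype.card_fin, nsmul_eq_mul]
    rw [hM]
    ring
  rw [hcount] at hsum
  have hBM : 0 ≤ B * M₃ := mul_nonneg hB0.le (by linarith)
  have hinv : (√M)⁻¹ ≤ 1 := inv_le_one_of_one_le₀ hc1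
  have hinv0 : 0 ≤ (√M)⁻¹ := by positivity
  have hMc : (√M)⁻¹ * M = √M := by
    rw [inv_mul_eq_div, Real.div_sqrt]
  have hℓsq : (ℓ : ℝ) ≤ (ℓ : ℝ) ^ 2 := by nlinarith
  have hexp : 0 ≤ Real.exp (Real.exp (Real.exp 1)) * M₃ := by positivity
  calc _ ≤ κ / 2 * (√M * (M₂ + B * M₃) + (√M)⁻¹ * (M * M₂ + (ℓ : ℝ) ^ 2 * (B * M₃))) := by
        gcongr
    _ = κ / 2 * (2 * √M * M₂ + √M * (B * M₃) + (√M)⁻¹ * ((ℓ : ℝ) ^ 2 * (B * M₃))) := by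
        rw [mul_add (√M)⁻¹, ← mul_assoc (√M)⁻¹ M, hMc]
        ring
    _ ≤ κ / 2 * (2 * √M * M₂ + (ℓ : ℝ) ^ 2 * (B * M₃) + 1 * ((ℓ : ℝ) ^ 2 * (B * M₃))) := by
        gcongr
        exact hcℓ.trans hℓsq
    _ = κ * √M * M₂ + κ * (ℓ : ℝ) ^ 2 * B * M₃ := by ring
    _ ≤ _ := by linarith
end
end
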